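/- arXiv:1502.00418 — 2 statements merged into one kernel-verified Lean document; each statement's English description precedes it below -/
import Mathlib

section
/- Let X be a complex Banach space and (a_n)_{n≥1} a sequence in X. Suppose there exists σ₀ ∈ ℝ such that the Dirichlet series Σ_n a_n n^{−s} converges in X for every s with Re s > σ₀, and suppose there exist r₁ ∈ ℝ and a bounded holomorphic function f : {s ∈ ℂ : Re s > r₁} → X such that f(s) = Σ_n a_n n^{−s} for all s with Re s > max(σ₀, r₁). Then for every r₀ > r₁ the series Σ_n a_n n^{−s} converges uniformly on {s ∈ ℂ : Re s > r₀}. (Abscissa of uniform convergence equals abscissa of boundedness.) -/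
open Filter Finset Topology

open MeasureTheory

lemma h_bound (t : ℝ) : ‖(1 - Real.cos t) / t ^ 2‖ ≤ 4 * (1 + t ^ 2)⁻¹ := by
  have h1 := Real.one_sub_sq_div_two_le_cos (x := t)
  have h2 := Real.neg_one_le_cos t
  have h3 := Real.cos_le_one t
  rw [Real.norm_of_nonneg (div_nonneg (by linarith) (sq_nonneg t))]
  rcases eq_or_ne t 0 with rfl | ht
  · simp
  have ht2 : 0 < t ^ 2 := by positivity
  rw [← div_eq_mul_inv, div_le_div_iff₀ ht2 (by positivity)]
  rcases le_total (t ^ 2) 1 with h | h <;> nlinarith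

lemma h_int : Integrable (fun t : ℝ => (1 - Real.cos t) / t ^ 2) := by
  refine (integrable_inv_one_add_sq.const_mul 4).mono' ?_ (ae_of_all _ h_bound)
  exact (by fun_prop : Measurable (fun t : ℝ => (1 - Real.cos t) / t ^ 2)).aestronglyMeasurable

noncomputable def cc : ℝ := ∫ t : ℝ, (1 - Real.cos t) / t ^ 2

lemma cc_pos : 0 < cc := by
  unfold cc
  rw [integral_pos_iff_support_of_nonneg _ h_int]
  · have : Set.Ioo (0:ℝ) 1 ⊆ Function.support (fun t : ℝ => (1 - Real.cos t) / t ^ 2) := by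
      intro t ht
      have h1 : Real.cos t < 1 := by
        have := Real.cos_lt_cos_of_nonneg_of_le_pi le_rfl (by linarith [Real.pi_gt_three, ht.2]) ht.1
        simpa using this
      have := ht.1
      exact ne_of_gt (div_pos (by linarith) (by positivity))
    refine lt_of_lt_of_le ?_ (measure_mono this)
    simp
  · intro t
    exact div_nonneg (by linarith [Real.cos_le_one t]) (sq_nonneg t)

lemma h_scale (a t : ℝ) : (1 - Real.cos (a * t)) / t ^ 2 = 
    a ^ 2 * ((1 - Real.cos (a * t)) / (a * t) ^ 2) := by
  rcases eq_or_ne a 0 with rfl | ha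
  · simp
  rcases eq_or_ne t 0 with rfl | ht
  · simp
  field_simp

lemma h_int' (a : ℝ) : Integrable (fun t : ℝ => (1 - Real.cos (a * t)) / t ^ 2) := by
  rcases eq_or_ne a 0 with rfl | ha
  · simp
  simp_rw [h_scale a]
  exact (h_int.comp_mul_left' ha).const_mul _

lemma h_integral (a : ℝ) : ∫ t : ℝ, (1 - Real.cos (a * t)) / t ^ 2 = cc * |a| := by
  rcases eq_or_ne a 0 with rfl | ha
  · simp
  simp_rw [h_scale a]
  rw [integral_const_mul, Measure.integral_comp_mul_left (fun t => (1 - Real.cos t) / t ^ 2)]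
  rw [← cc, smul_eq_mul, abs_inv, ← sq_abs]
  have : |a| ≠ 0 := by simpa
  field_simp

/-- trapezoid kernel -/
noncomputable def KK (A B t : ℝ) : ℝ := (Real.cos (A * t) - Real.cos (B * t)) / (cc * (B - A) * t ^ 2)

lemma KK_eq (A B t : ℝ) : KK A B t = (cc * (B - A))⁻¹ *
    ((1 - Real.cos (B * t)) / t ^ 2 - (1 - Real.cos (A * t)) / t ^ 2) := by
  unfold KK
  rw [div_eq_mul_inv, mul_inv]; ring

lemma KK_int (A B : ℝ) : Integrable (KK A B) := by
  rw [funext (KK_eq A B)]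
  exact ((h_int' B).sub (h_int' A)).const_mul _

lemma KK_cos (A B x : ℝ) (hAB : A < B) : ∫ t : ℝ, KK A B t * Real.cos (x * t) =
    (|B + x| + |B - x| - |A + x| - |A - x|) / (2 * (B - A)) := by
  have : ∀ t, KK A B t * Real.cos (x * t) = (cc * (B - A))⁻¹ * 2⁻¹ *
      ((1 - Real.cos ((B + x) * t)) / t ^ 2 + (1 - Real.cos ((B - x) * t)) / t ^ 2
      - (1 - Real.cos ((A + x) * t)) / t ^ 2 - (1 - Real.cos ((A - x) * t)) / t ^ 2) := by
    intro t
    unfold KK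
    rw [add_mul, add_mul, sub_mul, sub_mul, Real.cos_add, Real.cos_add, Real.cos_sub, Real.cos_sub,
      div_eq_mul_inv, mul_inv]
    ring
  simp_rw [this]
  rw [integral_const_mul, integral_sub, integral_sub, integral_add, h_integral, h_integral,
    h_integral, h_integral]
  · have := cc_pos.ne'
    have : B - A ≠ 0 := by linarith
    field_simp
  · exact h_int' _
  · exact h_int' _
  · exact (h_int' _).add (h_int' _)
  · exact h_int' _
  · exact ((h_int' _).add (h_int' _)).sub (h_int' _)
  · exact h_int' _

lemma KK_even (A B t : ℝ) : KK A B (-t) = KK A B t := by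
  simp [KK]

lemma KK_exp_int (A B x : ℝ) : Integrable fun t : ℝ => (KK A B t : ℂ) * Complex.exp (-(x * t : ℝ) * Complex.I) := by
  refine (KK_int A B).norm.mono' ?_ (ae_of_all _ fun t => ?_)
  · exact ((KK_int A B).ofReal.aestronglyMeasurable).mul (by fun_prop : Continuous _).aestronglyMeasurable
  · rw [norm_mul, ← Complex.ofReal_neg, Complex.norm_exp_ofReal_mul_I]
    simp

lemma KK_exp (A B x : ℝ) (hAB : A < B) :
    ∫ t : ℝ, (KK A B t : ℂ) * Complex.exp (-(x * t : ℝ) * Complex.I) =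
    (((|B + x| + |B - x| - |A + x| - |A - x|) / (2 * (B - A)) : ℝ) : ℂ) := by
  have e1 := integral_neg_eq_self (fun t : ℝ => (KK A B t : ℂ) * Complex.exp (-(x * t : ℝ) * Complex.I)) volume
  have i2 : Integrable fun t : ℝ => (KK A B (-t) : ℂ) * Complex.exp (-(x * (-t) : ℝ) * Complex.I) :=
    (KK_exp_int A B x).comp_neg
  have e2 := integral_add (KK_exp_int A B x) i2
  rw [e1] at e2
  rw [← KK_cos A B x hAB, ← integral_complex_ofReal]
  have e3 : ∀ t : ℝ, (KK A B t : ℂ) * Complex.exp (-(x * t : ℝ) * Complex.I) +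
      (KK A B (-t) : ℂ) * Complex.exp (-(x * (-t) : ℝ) * Complex.I) = 
      2 * ((KK A B t * Real.cos (x * t) : ℝ) : ℂ) := by
    intro t
    rw [KK_even]
    push_cast
    rw [Complex.cos]
    ring_nf
  simp_rw [e3] at e2
  rw [integral_const_mul] at e2
  linear_combination (-1/2 : ℂ) * e2

lemma KK_exp_one (A B x : ℝ) (hAB : A < B) (h0 : 0 ≤ x) (h : x ≤ A) :
    ∫ t : ℝ, (KK A B t : ℂ) * Complex.exp (-(x * t : ℝ) * Complex.I) = 1 := by
  rw [KK_exp A B x hAB, abs_of_nonneg (by linarith), abs_of_nonneg (by linarith),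
    abs_of_nonneg (by linarith), abs_of_nonneg (by linarith)]
  have : B - A ≠ 0 := by linarith
  norm_cast
  field_simp
  ring

lemma KK_exp_zero (A B x : ℝ) (hAB : A < B) (h0 : 0 ≤ A) (h : B ≤ x) :
    ∫ t : ℝ, (KK A B t : ℂ) * Complex.exp (-(x * t : ℝ) * Complex.I) = 0 := by
  rw [KK_exp A B x hAB, abs_of_nonneg (by linarith), abs_of_nonpos (by linarith),
    abs_of_nonneg (by linarith), abs_of_nonpos (by linarith)]
  norm_cast
  ring

lemma KK_bound (ε : ℝ) (h0 : 0 < ε) (h1 : ε ≤ 1) (N : ℕ) (hN : 1 ≤ N) (t : ℝ) :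
    |KK (Real.log N) (Real.log (N + 1)) t| ≤
      (cc⁻¹ * (1 / ε + 2) * 2 ^ (1 + ε)) * ((N:ℝ) + 1) ^ ε * (1 + ‖t‖) ^ (-(1 + ε)) := by
  have hN' : (1:ℝ) ≤ N := by exact_mod_cast hN
  set A := Real.log N with hA
  set B := Real.log (N + 1) with hB
  have hA0 : 0 ≤ A := Real.log_nonneg hN'
  have hBA : 1 / ((N:ℝ) + 1) ≤ B - A := by
    rw [hA, hB, ← Real.log_div (by positivity) (by positivity)]
    refine le_trans (le_of_eq ?_) (Real.one_sub_inv_le_log_of_pos (by positivity))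
    field_simp; ring
  have hBA0 : 0 < B - A := lt_of_lt_of_le (by positivity) hBA
  have hc := cc_pos
  have hBε : B ≤ ((N:ℝ) + 1) ^ ε / ε := Real.log_le_rpow_div (by positivity) h0
  have hcos : |Real.cos (A * t) - Real.cos (B * t)| =
      2 * |Real.sin ((A + B) / 2 * t)| * |Real.sin ((B - A) / 2 * t)| := by
    rw [Real.cos_sub_cos, abs_mul, abs_mul, abs_neg, abs_two,
      show (A * t + B * t) / 2 = (A + B) / 2 * t by ring,
      show (A * t - B * t) / 2 = -((B - A) / 2 * t) by ring, Real.sin_neg, abs_neg]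
  rcases eq_or_ne t 0 with rfl | ht
  · simp [KK]; positivity
  have htp : 0 < |t| := abs_pos.2 ht
  have key : |KK A B t| = (2 * |Real.sin ((A + B) / 2 * t)| * |Real.sin ((B - A) / 2 * t)|) / (cc * (B - A) * |t| ^ 2) := by
    rw [KK, abs_div, hcos, abs_of_pos (by positivity : 0 < cc * (B - A) * t ^ 2), sq_abs]
  have hNε : 0 < ((N:ℝ) + 1) ^ ε := by positivity
  rw [Real.norm_eq_abs]
  rcases le_total |t| 1 with h | h
  · have s1 : |Real.sin ((A + B) / 2 * t)| ≤ B * |t| := by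
      refine Real.abs_sin_le_abs.trans ?_
      rw [abs_mul, abs_of_nonneg (by linarith)]
      gcongr; linarith
    have s2 : |Real.sin ((B - A) / 2 * t)| ≤ (B - A) / 2 * |t| := by
      refine Real.abs_sin_le_abs.trans ?_
      rw [abs_mul, abs_of_nonneg (by linarith)]
    have hB0 : 0 ≤ B := by linarith
    have : |KK A B t| ≤ cc⁻¹ * B := by
      rw [key, div_le_iff₀ (by positivity)]
      calc _ ≤ 2 * (B * |t|) * ((B - A) / 2 * |t|) := by gcongr
        _ = _ := by field_simp
    refine this.trans ?_
    have e : 1 ≤ 2 ^ (1 + ε) * (1 + |t|) ^ (-(1 + ε)) := by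
      rw [Real.rpow_neg (by positivity), ← div_eq_mul_inv, one_le_div (by positivity)]
      gcongr; linarith
    calc cc⁻¹ * B ≤ cc⁻¹ * (((N:ℝ) + 1) ^ ε / ε) * 1 := by rw [mul_one]; gcongr
      _ ≤ (cc⁻¹ * ((1 / ε + 2) * ((N:ℝ) + 1) ^ ε)) * (2 ^ (1 + ε) * (1 + |t|) ^ (-(1 + ε))) := by
        gcongr
        rw [div_eq_mul_inv]
        have : 0 < ε⁻¹ := by positivity
        field_simp
        nlinarith
      _ = _ := by ring
  · have s1 : |Real.sin ((A + B) / 2 * t)| ≤ 1 := Real.abs_sin_le_one _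
    have s2 : |Real.sin ((B - A) / 2 * t)| ≤ ((B - A) * |t|) ^ (1 - ε) := by
      have q1 : |Real.sin ((B - A) / 2 * t)| ≤ ((B - A) * |t|) := by
        refine Real.abs_sin_le_abs.trans ?_
        rw [abs_mul, abs_of_nonneg (by linarith)]
        gcongr; linarith
      have q2 := Real.abs_sin_le_one ((B - A) / 2 * t)
      rcases le_total ((B - A) * |t|) 1 with hh | hh
      · refine q1.trans ?_
        exact Real.self_le_rpow_of_le_one (by positivity) hh (by linarith)
      · exact q2.trans (Real.one_le_rpow hh (by linarith))
    have b1 : (B - A) ^ (-ε) ≤ ((N:ℝ) + 1) ^ ε := by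
      rw [Real.rpow_neg hBA0.le, ← Real.inv_rpow hBA0.le]
      gcongr
      rw [inv_le_comm₀ hBA0 (by positivity)]
      simpa using hBA
    have b2 : |t| ^ (-(1 + ε)) ≤ 2 ^ (1 + ε) * (1 + |t|) ^ (-(1 + ε)) := by
      rw [Real.rpow_neg (by positivity), Real.rpow_neg (by positivity), ← div_eq_mul_inv, inv_eq_one_div,
        div_le_div_iff₀ (by positivity) (by positivity), one_mul, ← Real.mul_rpow (by positivity) (by positivity)]
      gcongr; linarith
    have : |KK A B t| ≤ cc⁻¹ * 2 * (B - A) ^ (-ε) * |t| ^ (-(1 + ε)) := by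
      rw [key, div_le_iff₀ (by positivity)]
      calc _ ≤ 2 * 1 * ((B - A) * |t|) ^ (1 - ε) := by gcongr
        _ = _ := by
          rw [Real.mul_rpow hBA0.le htp.le, sub_eq_add_neg 1 ε, Real.rpow_add hBA0, Real.rpow_add htp,
            neg_add, Real.rpow_add htp]
          simp only [Real.rpow_one]
          rw [Real.rpow_neg htp.le 1, Real.rpow_one]
          field_simp
    refine this.trans ?_
    calc _ ≤ cc⁻¹ * 2 * ((N:ℝ) + 1) ^ ε * (2 ^ (1 + ε) * (1 + |t|) ^ (-(1 + ε))) := by gcongr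
      _ ≤ cc⁻¹ * (1 / ε + 2) * ((N:ℝ) + 1) ^ ε * (2 ^ (1 + ε) * (1 + |t|) ^ (-(1 + ε))) := by
        gcongr
        have : 0 < 1 / ε := by positivity
        linarith
      _ = _ := by ring

lemma KK_norm (ε : ℝ) (h0 : 0 < ε) (h1 : ε ≤ 1) : ∃ D : ℝ, 0 ≤ D ∧ ∀ N : ℕ, 1 ≤ N →
    ∫ t : ℝ, |KK (Real.log N) (Real.log (N + 1)) t| ≤ D * (N : ℝ) ^ ε := by
  have hc := cc_pos
  refine ⟨(cc⁻¹ * (1 / ε + 2) * 2 ^ (1 + ε)) * 2 ^ ε * ∫ t : ℝ, (1 + ‖t‖) ^ (-(1 + ε)),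
    mul_nonneg (by positivity) (integral_nonneg fun t => by positivity), fun N hN => ?_⟩
  have hN' : (1:ℝ) ≤ N := by exact_mod_cast hN
  have hi : Integrable fun t : ℝ => (1 + ‖t‖) ^ (-(1 + ε)) :=
    integrable_one_add_norm (by simp; linarith)
  have h2 : ((N:ℝ) + 1) ^ ε ≤ 2 ^ ε * (N:ℝ) ^ ε := by
    rw [← Real.mul_rpow (by positivity) (by positivity)]
    gcongr; linarith
  have hp : 0 ≤ ∫ t : ℝ, (1 + ‖t‖) ^ (-(1 + ε)) := integral_nonneg fun t => by positivity
  calc _ ≤ ∫ t : ℝ, (cc⁻¹ * (1 / ε + 2) * 2 ^ (1 + ε)) * ((N:ℝ) + 1) ^ ε * (1 + ‖t‖) ^ (-(1 + ε)) :=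
        integral_mono (KK_int _ _).abs (hi.const_mul _) (KK_bound ε h0 h1 N hN)
    _ = (cc⁻¹ * (1 / ε + 2) * 2 ^ (1 + ε)) * ((N:ℝ) + 1) ^ ε * ∫ t : ℝ, (1 + ‖t‖) ^ (-(1 + ε)) := by
        rw [integral_const_mul]
    _ ≤ (cc⁻¹ * (1 / ε + 2) * 2 ^ (1 + ε)) * (2 ^ ε * (N:ℝ) ^ ε) * ∫ t : ℝ, (1 + ‖t‖) ^ (-(1 + ε)) := by
        gcongr
    _ = _ := by ring

lemma halfplane_open (r : ℝ) : IsOpen {s : ℂ | r < s.re} :=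
  isOpen_lt continuous_const Complex.continuous_re

lemma halfplane_ident {X : Type*} [NormedAddCommGroup X] [NormedSpace ℂ X] [CompleteSpace X]
    (r R : ℝ) (f g : ℂ → X) (hf : DifferentiableOn ℂ f {s : ℂ | r < s.re})
    (hg : DifferentiableOn ℂ g {s : ℂ | r < s.re}) (h : ∀ s : ℂ, R < s.re → f s = g s) :
    ∀ s : ℂ, r < s.re → f s = g s := by
  have ho := halfplane_open r
  have hpc : IsPreconnected {s : ℂ | r < s.re} := (convex_halfSpace_re_gt r).isPreconnected
  set z : ℂ := ((max r R + 1 : ℝ) : ℂ) with hz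
  have hzr : z.re = max r R + 1 := by simp [hz]
  have h1 := le_max_left r R
  have h2 := le_max_right r R
  have hev : f =ᶠ[𝓝 z] g := by
    filter_upwards [(halfplane_open R).mem_nhds (show R < z.re by linarith)] with s hs using h s hs
  exact fun s hs => (hf.analyticOnNhd ho).eqOn_of_preconnected_of_eventuallyEq (hg.analyticOnNhd ho) hpc
    (show r < z.re by linarith) hev hs

lemma conv_diff {X : Type*} [NormedAddCommGroup X] [NormedSpace ℂ X] [CompleteSpace X]
    (r C : ℝ) (f : ℂ → X) (hf : DifferentiableOn ℂ f {s : ℂ | r < s.re})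
    (hC : ∀ s : ℂ, r < s.re → ‖f s‖ ≤ C) (K : ℝ → ℝ) (hK : Integrable K) :
    DifferentiableOn ℂ (fun s => ∫ t : ℝ, (K t : ℂ) • f (s + t * Complex.I)) {s : ℂ | r < s.re} := by
  intro s₀ hs₀
  have hs₀' : r < s₀.re := hs₀
  have ho := halfplane_open r
  have hcont : ∀ g : ℂ → X, ContinuousOn g {s : ℂ | r < s.re} → ∀ s : ℂ, r < s.re →
      Continuous fun t : ℝ => g (s + t * Complex.I) := by
    intro g hg s hs
    exact hg.comp_continuous (by fun_prop) (fun t => by simpa using hs)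
  have hKm : AEStronglyMeasurable (fun t : ℝ => (K t : ℂ)) volume := hK.ofReal.aestronglyMeasurable
  set η := (s₀.re - r) / 2 with hη
  have hη0 : 0 < η := by rw [hη]; linarith
  have hnhds : {s : ℂ | r + η < s.re} ∈ 𝓝 s₀ :=
    (halfplane_open _).mem_nhds (show r + η < s₀.re by rw [hη]; linarith)
  have hder : ∀ s : ℂ, r + η < s.re → ‖deriv f s‖ ≤ C / η := by
    intro s hs
    have hsub : Metric.closedBall s η ⊆ {s : ℂ | r < s.re} := by
      intro z hz
      have h1 : |(z - s).re| ≤ η := (Complex.abs_re_le_norm _).trans (by simpa [dist_eq_norm] using hz)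
      have h2 := (abs_le.1 h1).1
      simp only [Complex.sub_re] at h2
      show r < z.re
      linarith
    refine Complex.norm_deriv_le_of_forall_mem_sphere_norm_le hη0 ?_
      (fun z hz => hC z (hsub (Metric.sphere_subset_closedBall hz)))
    exact (hf.mono hsub).diffContOnCl_ball subset_rfl
  have hmain := hasDerivAt_integral_of_dominated_loc_of_deriv_le (μ := volume) (𝕜 := ℂ)
    (F := fun (s : ℂ) (t : ℝ) => (K t : ℂ) • f (s + t * Complex.I))
    (F' := fun (s : ℂ) (t : ℝ) => (K t : ℂ) • deriv f (s + t * Complex.I))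
    (bound := fun t => |K t| * (C / η)) (x₀ := s₀) hnhds ?_ ?_ ?_ ?_ ?_ ?_
  · exact hmain.2.differentiableAt.differentiableWithinAt
  · filter_upwards [ho.mem_nhds hs₀'] with s hs
    exact hKm.smul (hcont f hf.continuousOn s hs).aestronglyMeasurable
  · refine (hK.abs.mul_const C).mono' (hKm.smul (hcont f hf.continuousOn s₀ hs₀).aestronglyMeasurable)
      (ae_of_all _ fun t => ?_)
    rw [norm_smul, Complex.norm_real, Real.norm_eq_abs]
    gcongr
    exact hC _ (by simpa using hs₀')
  · exact hKm.smul (hcont (deriv f) (hf.deriv ho).continuousOn s₀ hs₀).aestronglyMeasurable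
  · refine ae_of_all _ fun t s hs => ?_
    rw [norm_smul, Complex.norm_real, Real.norm_eq_abs]
    gcongr
    exact hder _ (by simpa using hs)
  · exact hK.abs.mul_const _
  · refine ae_of_all _ fun t s hs => ?_
    have hs' : r + η < s.re := hs
    have hd : HasDerivAt f (deriv f (s + t * Complex.I)) (s + t * Complex.I) :=
      (hf.differentiableAt (ho.mem_nhds (show r < (s + t * Complex.I).re by simp; linarith))).hasDerivAt
    exact (hd.comp_add_const s (t * Complex.I)).const_smul (K t : ℂ)

/-- Abel summation. -/
lemma abel_bound {X : Type*} [NormedAddCommGroup X] [NormedSpace ℂ X]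
    (b : ℕ → X) (u : ℕ → ℝ) (D : ℝ) (hD : 0 ≤ D) (hu : ∀ n, 0 < u n) (hanti : Antitone u)
    (hS : ∀ N, ‖∑ n ∈ Finset.range (N + 1), b n‖ * u N ≤ D) (M N : ℕ) (hMN : M ≤ N) :
    ‖∑ n ∈ Finset.range N, ((u n ^ 2 : ℝ) : ℂ) • b n - ∑ n ∈ Finset.range M, ((u n ^ 2 : ℝ) : ℂ) • b n‖
      ≤ 4 * D * u M := by
  set S : ℕ → X := fun N => ∑ n ∈ Finset.range N, b n with hSdef
  set T : ℕ → X := fun N => ∑ n ∈ Finset.range N, ((u n ^ 2 : ℝ) : ℂ) • b n with hTdef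
  set E : ℕ → X := fun N => T N - ((u N ^ 2 : ℝ) : ℂ) • S N with hE
  have hstep : ∀ n, E (n + 1) - E n = ((u n ^ 2 - u (n + 1) ^ 2 : ℝ) : ℂ) • S (n + 1) := by
    intro n
    simp only [hE, hTdef, hSdef, Finset.sum_range_succ]
    push_cast
    module
  have hstepn : ∀ n, ‖E (n + 1) - E n‖ ≤ 2 * D * (u n - u (n + 1)) := by
    intro n
    have h1 : u (n + 1) ≤ u n := hanti (Nat.le_succ n)
    have h2 := hS n
    have h3 := hu n
    have h4 := hu (n + 1)
    rw [hstep, norm_smul, Complex.norm_real, Real.norm_of_nonneg (by nlinarith)]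
    have h5 : 0 ≤ ‖S (n + 1)‖ := norm_nonneg _
    calc (u n ^ 2 - u (n + 1) ^ 2) * ‖S (n + 1)‖
        = (u n - u (n+1)) * ((u n + u (n + 1)) * ‖S (n + 1)‖) := by ring
      _ ≤ (u n - u (n+1)) * ((2 * u n) * ‖S (n + 1)‖) := by
        gcongr
        · linarith
      _ = (u n - u (n+1)) * (2 * (‖S (n + 1)‖ * u n)) := by ring
      _ ≤ (u n - u (n+1)) * (2 * D) := by
        gcongr
      _ = _ := by ring
  have hEE : ‖E N - E M‖ ≤ 2 * D * (u M - u N) := by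
    induction N, hMN using Nat.le_induction with
    | base => simp
    | succ n hn ih =>
      calc ‖E (n + 1) - E M‖ ≤ ‖E (n + 1) - E n‖ + ‖E n - E M‖ := norm_sub_le_norm_sub_add_norm_sub _ _ _
        _ ≤ _ := by linarith [hstepn n]
  have hSu : ∀ n, ‖((u n ^ 2 : ℝ) : ℂ) • S n‖ ≤ D * u n := by
    intro n
    rw [norm_smul, Complex.norm_real, Real.norm_of_nonneg (by positivity)]
    rcases n with _ | n
    · simp [hSdef]; exact mul_nonneg hD (hu 0).le
    · have h1 : u (n + 1) ≤ u n := hanti (Nat.le_succ n)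
      have h4 := hu (n + 1)
      have h5 : 0 ≤ ‖S (n + 1)‖ := norm_nonneg _
      have h6 : ‖S (n + 1)‖ * u (n + 1) ≤ D := le_trans (by gcongr) (hS n)
      calc _ = (‖S (n + 1)‖ * u (n + 1)) * u (n + 1) := by ring
        _ ≤ _ := by gcongr
  have hTT : T N - T M = (E N - E M) + ((u N ^ 2 : ℝ) : ℂ) • S N - ((u M ^ 2 : ℝ) : ℂ) • S M := by
    simp only [hE]; abel
  have huNM := hanti hMN
  rw [hTT]
  calc _ ≤ ‖E N - E M‖ + ‖((u N ^ 2 : ℝ) : ℂ) • S N‖ + ‖((u M ^ 2 : ℝ) : ℂ) • S M‖ :=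
        (norm_sub_le _ _).trans (by gcongr; exact norm_add_le _ _)
    _ ≤ 2 * D * (u M - u N) + D * u N + D * u M := by
        gcongr
        · exact hSu N
        · exact hSu M
    _ ≤ _ := by nlinarith [hu N, hu M, mul_nonneg hD (hu N).le, mul_nonneg hD (hu M).le]

lemma cpow_shift (n : ℕ) (s : ℂ) (t : ℝ) : (((n + 1 : ℕ) : ℂ) ^ (-(s + t * Complex.I))) =
    ((n + 1 : ℕ) : ℂ) ^ (-s) * Complex.exp (-(Real.log (n + 1) * t : ℝ) * Complex.I) := by
  have h : ((n + 1 : ℕ) : ℂ) ≠ 0 := by exact_mod_cast Nat.succ_ne_zero n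
  rw [neg_add, Complex.cpow_add _ _ h, Complex.cpow_def_of_ne_zero h (-(t * Complex.I)), ← Complex.natCast_log]
  congr 2
  push_cast
  ring

lemma cpow_norm (n : ℕ) (s : ℂ) : ‖((n + 1 : ℕ) : ℂ) ^ (-s)‖ = ((n:ℝ) + 1) ^ (-s.re) := by
  rw [Complex.norm_natCast_cpow_of_pos (Nat.succ_pos n)]
  simp

/-- Far to the right, the series converges absolutely. -/
lemma abs_conv {X : Type*} [NormedAddCommGroup X] [NormedSpace ℂ X]
    (a : ℕ → X) (σ : ℝ) 
    (hconv : ∃ L : X, Tendsto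
      (fun N : ℕ => ∑ n ∈ Finset.range N, (((n + 1 : ℕ) : ℂ) ^ (-(σ : ℂ))) • a (n + 1))
      atTop (𝓝 L)) (τ : ℝ) (hτ : σ + 2 ≤ τ) :
    Summable fun n : ℕ => ((n:ℝ) + 1) ^ (-τ) * ‖a (n + 1)‖ := by
  obtain ⟨L, hL⟩ := hconv
  have h0 : Tendsto (fun n : ℕ => (((n + 1 : ℕ) : ℂ) ^ (-(σ : ℂ))) • a (n + 1)) atTop (𝓝 0) := by
    have := ((tendsto_add_atTop_iff_nat 1).2 hL).sub hL
    simpa [Finset.sum_range_succ] using this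
  obtain ⟨C, hC⟩ := (Metric.isBounded_range_of_tendsto _ h0).exists_norm_le
  have hC' : ∀ n : ℕ, ((n:ℝ) + 1) ^ (-σ) * ‖a (n + 1)‖ ≤ C := by
    intro n
    have := hC _ ⟨n, rfl⟩
    simpa only [norm_smul, cpow_norm, Complex.ofReal_re] using this
  have hs : Summable fun n : ℕ => C * (1 / ((n + 1 : ℕ) : ℝ) ^ 2) :=
    ((summable_nat_add_iff 1).2 (Real.summable_one_div_nat_pow.2 one_lt_two)).mul_left C
  refine Summable.of_nonneg_of_le (fun n => by positivity) (fun n => ?_) hs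
  have hn : (1:ℝ) ≤ (n:ℝ) + 1 := by linarith [Nat.cast_nonneg (α := ℝ) n]
  calc ((n:ℝ) + 1) ^ (-τ) * ‖a (n + 1)‖ ≤ ((n:ℝ) + 1) ^ (-σ + (-2:ℝ)) * ‖a (n + 1)‖ := by
        gcongr
        · linarith
    _ = (((n:ℝ) + 1) ^ (-σ) * ‖a (n + 1)‖) * (1 / ((n + 1 : ℕ) : ℝ) ^ 2) := by
        rw [Real.rpow_add (by positivity), Real.rpow_neg (by positivity) 2, Real.rpow_two]
        push_cast
        ring
    _ ≤ _ := by gcongr; exact hC' n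

section
variable {X : Type*} [NormedAddCommGroup X] [NormedSpace ℂ X] [CompleteSpace X]
    (a : ℕ → X) (σ₀ r₁ : ℝ) (f : ℂ → X)

lemma conv_eq_right 
    (hconv : ∀ s : ℂ, σ₀ < s.re → ∃ L : X, Tendsto
      (fun N : ℕ => ∑ n ∈ Finset.range N, (((n + 1 : ℕ) : ℂ) ^ (-s)) • a (n + 1))
      atTop (𝓝 L))
    (hagree : ∀ s : ℂ, max σ₀ r₁ < s.re → Tendsto
      (fun N : ℕ => ∑ n ∈ Finset.range N, (((n + 1 : ℕ) : ℂ) ^ (-s)) • a (n + 1))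
      atTop (𝓝 (f s))) (N : ℕ) (hN : 1 ≤ N) (s : ℂ) (hs : max σ₀ r₁ + 3 < s.re) :
    ∫ t : ℝ, (KK (Real.log N) (Real.log (N + 1)) t : ℂ) • f (s + t * Complex.I) =
      ∑ n ∈ Finset.range N, (((n + 1 : ℕ) : ℂ) ^ (-s)) • a (n + 1) := by
  have hN' : (1:ℝ) ≤ N := by exact_mod_cast hN
  set A := Real.log N with hA
  set B := Real.log (N + 1) with hB
  have hA0 : 0 ≤ A := Real.log_nonneg hN'
  have hAB : A < B := Real.log_lt_log (by linarith) (by linarith)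
  have hm := le_max_left σ₀ r₁
  have hsum : Summable fun n : ℕ => ((n:ℝ) + 1) ^ (-s.re) * ‖a (n + 1)‖ :=
    abs_conv a (σ₀ + 1) (hconv _ (by simp)) _ (by linarith)
  have hterm : ∀ (n : ℕ) (t : ℝ), (KK A B t : ℂ) • (((n + 1 : ℕ) : ℂ) ^ (-(s + t * Complex.I))) • a (n + 1) =
      ((KK A B t : ℂ) * Complex.exp (-(Real.log (n + 1) * t : ℝ) * Complex.I)) •
        ((((n + 1 : ℕ) : ℂ) ^ (-s)) • a (n + 1)) := by
    intro n t
    rw [cpow_shift, smul_smul, smul_smul]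
    congr 1
    ring
  have hint : ∀ n : ℕ, Integrable fun t : ℝ => (KK A B t : ℂ) • (((n + 1 : ℕ) : ℂ) ^ (-(s + t * Complex.I))) • a (n + 1) := by
    intro n
    simp_rw [hterm]
    exact (KK_exp_int A B _).smul_const _
  have hval : ∀ n : ℕ, ∫ t : ℝ, (KK A B t : ℂ) • (((n + 1 : ℕ) : ℂ) ^ (-(s + t * Complex.I))) • a (n + 1) =
      if n < N then (((n + 1 : ℕ) : ℂ) ^ (-s)) • a (n + 1) else 0 := by
    intro n
    simp_rw [hterm]
    rw [integral_smul_const]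
    have hn0 : (0:ℝ) ≤ n := Nat.cast_nonneg n
    split_ifs with h
    · rw [KK_exp_one A B _ hAB (Real.log_nonneg (by linarith)), one_smul]
      apply Real.log_le_log (by linarith)
      exact_mod_cast h
    · rw [KK_exp_zero A B _ hAB hA0, zero_smul]
      apply Real.log_le_log (by linarith)
      have : (N:ℝ) ≤ n := by exact_mod_cast not_lt.1 h
      linarith
  have hlim := tendsto_integral_of_dominated_convergence (μ := volume)
    (F := fun (M : ℕ) (t : ℝ) => ∑ n ∈ Finset.range M, (KK A B t : ℂ) • (((n + 1 : ℕ) : ℂ) ^ (-(s + t * Complex.I))) • a (n + 1))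
    (f := fun t : ℝ => (KK A B t : ℂ) • f (s + t * Complex.I))
    (fun t => |KK A B t| * ∑' n : ℕ, ((n:ℝ) + 1) ^ (-s.re) * ‖a (n + 1)‖) ?_ ?_ ?_ ?_
  · refine tendsto_nhds_unique hlim (tendsto_const_nhds.congr' ?_)
    filter_upwards [eventually_ge_atTop N] with M hM
    rw [integral_finsetSum _ fun n _ => hint n]
    simp_rw [hval]
    rw [← Finset.sum_filter]
    congr 1
    ext n
    simp only [Finset.mem_range, Finset.mem_filter]
    omega
  · intro M
    exact (integrable_finsetSum _ fun n _ => hint n).aestronglyMeasurable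
  · exact (KK_int A B).abs.mul_const _
  · refine fun M => ae_of_all _ fun t => ?_
    rw [← Finset.smul_sum, norm_smul, Complex.norm_real, Real.norm_eq_abs]
    gcongr
    refine (norm_sum_le _ _).trans (le_trans (le_of_eq ?_) (hsum.sum_le_tsum (Finset.range M) (fun n _ => by positivity)))
    refine Finset.sum_congr rfl fun n _ => ?_
    rw [norm_smul, cpow_norm]
    simp
  · refine ae_of_all _ fun t => ?_
    simp_rw [← Finset.smul_sum]
    exact (hagree _ (by simp at hs ⊢; constructor <;> linarith [le_max_left σ₀ r₁, le_max_right σ₀ r₁])).const_smul _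

end

lemma cpow_differentiable {X : Type*} [NormedAddCommGroup X] [NormedSpace ℂ X] (a : ℕ → X) (N : ℕ) :
    Differentiable ℂ fun s : ℂ => ∑ n ∈ Finset.range N, (((n + 1 : ℕ) : ℂ) ^ (-s)) • a (n + 1) := by
  refine Differentiable.fun_sum fun n _ => ?_
  refine Differentiable.smul_const ?_ _
  exact differentiable_neg.const_cpow (Or.inl (by exact_mod_cast Nat.succ_ne_zero n))

theorem dirichlet_uniform_convergence_of_bounded_holomorphic
    {X : Type*} [NormedAddCommGroup X] [NormedSpace ℂ X] [CompleteSpace X]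
    (a : ℕ → X) (σ₀ r₁ : ℝ) (f : ℂ → X)
    (hconv : ∀ s : ℂ, σ₀ < s.re → ∃ L : X, Tendsto
      (fun N : ℕ => ∑ n ∈ Finset.range N, (((n + 1 : ℕ) : ℂ) ^ (-s)) • a (n + 1))
      atTop (𝓝 L))
    (hf : DifferentiableOn ℂ f {s : ℂ | r₁ < s.re})
    (hbdd : ∃ C : ℝ, ∀ s : ℂ, r₁ < s.re → ‖f s‖ ≤ C)
    (hagree : ∀ s : ℂ, max σ₀ r₁ < s.re → Tendsto
      (fun N : ℕ => ∑ n ∈ Finset.range N, (((n + 1 : ℕ) : ℂ) ^ (-s)) • a (n + 1))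
      atTop (𝓝 (f s)))
    (r₀ : ℝ) (hr₀ : r₁ < r₀) :
    TendstoUniformlyOn
      (fun (N : ℕ) (s : ℂ) => ∑ n ∈ Finset.range N, (((n + 1 : ℕ) : ℂ) ^ (-s)) • a (n + 1))
      f atTop {s : ℂ | r₀ < s.re} := by
  obtain ⟨C, hC⟩ := hbdd
  have hC0 : 0 ≤ C := (norm_nonneg _).trans (hC ((r₁ + 1 : ℝ) : ℂ) (by simp))
  set ε : ℝ := min ((r₀ - r₁) / 2) 1 with hε
  have hε0 : 0 < ε := lt_min (by linarith) one_pos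
  have hε1 : ε ≤ 1 := min_le_right _ _
  have hε2 : 2 * ε ≤ r₀ - r₁ := by linarith [min_le_left ((r₀ - r₁) / 2) 1]
  obtain ⟨D, hD0, hD⟩ := KK_norm ε hε0 hε1
  -- partial sums grow at most like `N ^ ε` on the half plane of boundedness
  have hpart : ∀ (N : ℕ), 1 ≤ N → ∀ s : ℂ, r₁ < s.re →
      ‖∑ n ∈ Finset.range N, (((n + 1 : ℕ) : ℂ) ^ (-s)) • a (n + 1)‖ ≤ C * D * (N : ℝ) ^ ε := by
    intro N hN s hs
    rw [← halfplane_ident r₁ (max σ₀ r₁ + 3) _ _ (conv_diff r₁ C f hf hC _ (KK_int (Real.log N) (Real.log (N + 1))))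
      (cpow_differentiable a N).differentiableOn
      (fun s hs => conv_eq_right a σ₀ r₁ f hconv hagree N hN s hs) s hs]
    calc _ ≤ ∫ t : ℝ, |KK (Real.log N) (Real.log (N + 1)) t| * C := by
          refine norm_integral_le_of_norm_le ((KK_int _ _).abs.mul_const C) (ae_of_all _ fun t => ?_)
          rw [norm_smul, Complex.norm_real, Real.norm_eq_abs]
          gcongr
          exact hC _ (by simpa using hs)
      _ = (∫ t : ℝ, |KK (Real.log N) (Real.log (N + 1)) t|) * C := integral_mul_const _ _
      _ ≤ (D * (N : ℝ) ^ ε) * C := by gcongr; exact hD N hN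
      _ = _ := by ring
  set u : ℕ → ℝ := fun n => ((n:ℝ) + 1) ^ (-ε) with hu
  have hu0 : ∀ n, 0 < u n := fun n => by simp only [hu]; positivity
  have hanti : Antitone u := by
    intro m n hmn
    have : (m:ℝ) ≤ n := by exact_mod_cast hmn
    exact Real.rpow_le_rpow_of_nonpos (by positivity) (by linarith) (by linarith)
  have hulim : Tendsto u atTop (𝓝 0) := by
    have h1 : Tendsto (fun n : ℕ => (n:ℝ) + 1) atTop atTop :=
      tendsto_atTop_add_const_right _ _ tendsto_natCast_atTop_atTop
    exact (tendsto_rpow_neg_atTop hε0).comp h1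
  have hu2 : ∀ (n : ℕ) (s : ℂ), ((n + 1 : ℕ) : ℂ) ^ (-s) =
      ((u n ^ 2 : ℝ) : ℂ) * ((n + 1 : ℕ) : ℂ) ^ (-(s - (2 * ε : ℝ))) := by
    intro n s
    have h : ((n + 1 : ℕ) : ℂ) ≠ 0 := by exact_mod_cast Nat.succ_ne_zero n
    have h2 : ((u n ^ 2 : ℝ) : ℂ) = ((n + 1 : ℕ) : ℂ) ^ ((-(2 * ε) : ℝ) : ℂ) := by
      simp only [hu]
      rw [← Real.rpow_natCast, ← Real.rpow_mul (by positivity), Complex.ofReal_cpow (by positivity)]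
      push_cast
      ring_nf
    rw [h2, ← Complex.cpow_add _ _ h]
    congr 1
    push_cast
    ring
  have hcauchy : ∀ s : ℂ, r₀ < s.re → ∀ M N : ℕ, M ≤ N →
      ‖∑ n ∈ Finset.range N, (((n + 1 : ℕ) : ℂ) ^ (-s)) • a (n + 1) -
        ∑ n ∈ Finset.range M, (((n + 1 : ℕ) : ℂ) ^ (-s)) • a (n + 1)‖ ≤ 4 * (C * D) * u M := by
    intro s hs M N hMN
    have := abel_bound (fun n => ((n + 1 : ℕ) : ℂ) ^ (-(s - (2 * ε : ℝ))) • a (n + 1)) u (C * D)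
      (by positivity) hu0 hanti (fun n => ?_) M N hMN
    · simp_rw [smul_smul, ← hu2] at this
      exact this
    · have h1 := hpart (n + 1) (by omega) (s - (2 * ε : ℝ)) (by
        rw [Complex.sub_re, Complex.ofReal_re]; linarith)
      calc _ ≤ C * D * ((n + 1 : ℕ) : ℝ) ^ ε * u n := by gcongr
        _ = C * D := by
          simp only [hu]
          rw [Real.rpow_neg (by positivity)]
          push_cast
          field_simp
  have hUC : UniformCauchySeqOn
      (fun (N : ℕ) (s : ℂ) => ∑ n ∈ Finset.range N, (((n + 1 : ℕ) : ℂ) ^ (-s)) • a (n + 1))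
      atTop {s : ℂ | r₀ < s.re} := by
    rw [Metric.uniformCauchySeqOn_iff]
    intro δ hδ
    have hl : Tendsto (fun M => 4 * (C * D) * u M) atTop (𝓝 0) := by
      simpa using hulim.const_mul (4 * (C * D))
    obtain ⟨M, hM⟩ := (hl.eventually (gt_mem_nhds (half_pos hδ))).exists
    refine ⟨M, fun m hm n hn s hs => ?_⟩
    have h1 := hcauchy s hs M m hm
    have h2 := hcauchy s hs M n hn
    refine (dist_triangle_right _ _ (∑ n ∈ Finset.range M, (((n + 1 : ℕ) : ℂ) ^ (-s)) • a (n + 1))).trans_lt ?_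
    rw [dist_eq_norm, dist_eq_norm]
    linarith
  -- the pointwise limit
  have hex : ∀ s : ℂ, ∃ L : X, r₀ < s.re → Tendsto
      (fun N : ℕ => ∑ n ∈ Finset.range N, (((n + 1 : ℕ) : ℂ) ^ (-s)) • a (n + 1)) atTop (𝓝 L) := by
    intro s
    by_cases hs : r₀ < s.re
    · obtain ⟨L, hL⟩ := cauchySeq_tendsto_of_complete (hUC.cauchySeq hs)
      exact ⟨L, fun _ => hL⟩
    · exact ⟨0, fun h => absurd h hs⟩
  choose g hg using hex
  have hUg := hUC.tendstoUniformlyOn_of_tendsto (f := g) (fun s hs => hg s hs)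
  have hgd : DifferentiableOn ℂ g {s : ℂ | r₀ < s.re} :=
    hUg.tendstoLocallyUniformlyOn.differentiableOn
      (Eventually.of_forall fun N => (cpow_differentiable a N).differentiableOn) (halfplane_open r₀)
  refine hUg.congr_right fun s hs => ?_
  refine halfplane_ident r₀ (max (max σ₀ r₁) r₀) g f hgd
    (hf.mono fun s (hs : r₀ < s.re) => lt_trans hr₀ hs) (fun s hs => ?_) s hs
  exact tendsto_nhds_unique (hg s ((le_max_right _ _).trans_lt hs))
    (hagree s ((le_max_left _ _).trans_lt hs))
end

section
/- Let X be an infinite-dimensional complex Banach space that has cotype q for some q ∈ [2, ∞). Then G_a(X) = 1 − 1/Cot(X), where Cot(X) := inf{p ∈ [2, ∞) : X has cotype p} and G_a(X) is the gap for absolute convergence of Dirichlet series in X. -/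
open Filter Finset Topology

/-- The abscissa of convergence `σ_c(D)` of the Dirichlet series `D = ∑ₙ aₙ n^{-s}`,
as an extended real number. -/
noncomputable def dirichletSigmaC {X : Type*} [NormedAddCommGroup X] [NormedSpace ℂ X]
    (a : ℕ → X) : EReal :=
  sInf { x : EReal | ∃ r : ℝ, x = (r : EReal) ∧ ∀ s : ℂ, r < s.re →
    ∃ L : X, Tendsto
      (fun N : ℕ => ∑ n ∈ Finset.range N, (((n + 1 : ℕ) : ℂ) ^ (-s)) • a (n + 1))
      atTop (𝓝 L) }

/-- The abscissa of absolute convergence `σ_a(D)` of `D = ∑ₙ aₙ n^{-s}`. -/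
noncomputable def dirichletSigmaA {X : Type*} [SeminormedAddCommGroup X]
    (a : ℕ → X) : EReal :=
  sInf { x : EReal | ∃ r : ℝ, x = (r : EReal) ∧ ∀ σ : ℝ, r < σ →
    Summable (fun n : ℕ => ‖a (n + 1)‖ * ((n + 1 : ℕ) : ℝ) ^ (-σ)) }

/-- The abscissa of weak absolute convergence `σ_a^w(D) = sup_{x'} σ_a(x'(D))`. -/
noncomputable def dirichletSigmaAw {X : Type*} [NormedAddCommGroup X] [NormedSpace ℂ X]
    (a : ℕ → X) : EReal :=
  ⨆ x' : X →L[ℂ] ℂ, dirichletSigmaA (fun n => x' (a n))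

/-- The gap for absolute convergence of Dirichlet series in `X`:
`G_a(X) = sup_D (σ_a(D) - σ_a^w(D))`, the supremum over all Dirichlet series with
coefficients in `X` and finite abscissa of convergence. -/
noncomputable def dirichletGapA (X : Type*) [NormedAddCommGroup X] [NormedSpace ℂ X] :
    EReal :=
  sSup { g : EReal | ∃ a : ℕ → X, dirichletSigmaC a < ⊤ ∧
    g = dirichletSigmaA a - dirichletSigmaAw a }

/-- `X` has cotype `p ∈ [2,∞)`: there is `C > 0` with
`(∑ ‖xₙ‖^p)^{1/p} ≤ C (2^{-N} ∑_{ε ∈ {-1,1}^N} ‖∑ εₙ xₙ‖²)^{1/2}` for all finite families. -/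
def HasCotype (X : Type*) [NormedAddCommGroup X] [NormedSpace ℂ X] (p : ℝ) : Prop :=
  ∃ C : ℝ, 0 < C ∧ ∀ N : ℕ, ∀ x : Fin N → X,
    (∑ n : Fin N, ‖x n‖ ^ p) ^ (1 / p) ≤
      C * ((2 : ℝ) ^ (-(N : ℝ)) *
        ∑ ε : Fin N → Bool, ‖∑ n : Fin N, (if ε n then (1 : ℝ) else -1) • x n‖ ^ 2) ^ ((1 : ℝ) / 2)


namespace GapProof

def sg (b : Bool) : ℝ := if b then 1 else -1

lemma sg_not (b : Bool) : sg (!b) = - sg b := by cases b <;> simp [sg]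
lemma sg_sq (b : Bool) : sg b ^ 2 = 1 := by cases b <;> simp [sg]
lemma abs_sg (b : Bool) : |sg b| = 1 := by cases b <;> simp [sg]

section flip
variable {ι : Type*} [DecidableEq ι]

def flipAt (a : ι) (ε : ι → Bool) : ι → Bool := Function.update ε a (!ε a)

lemma flipAt_flipAt (a : ι) (ε : ι → Bool) : flipAt a (flipAt a ε) = ε := by
  funext i
  by_cases h : i = a
  · subst h; simp [flipAt]
  · simp [flipAt, h]

lemma flipAt_same (a : ι) (ε : ι → Bool) : flipAt a ε a = !ε a := by simp [flipAt]
lemma flipAt_ne {a i : ι} (h : i ≠ a) (ε : ι → Bool) : flipAt a ε i = ε i := by simp [flipAt, h]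

def flipEquiv (a : ι) : (ι → Bool) ≃ (ι → Bool) :=
  ⟨flipAt a, flipAt a, flipAt_flipAt a, flipAt_flipAt a⟩

lemma sum_flip [Fintype ι] (a : ι) (F : (ι → Bool) → ℝ) :
    ∑ ε, F (flipAt a ε) = ∑ ε, F ε := (flipEquiv a).sum_comp F

lemma sum_not [Fintype ι] (F : (ι → Bool) → ℝ) :
    ∑ ε : ι → Bool, F (fun i => !ε i) = ∑ ε, F ε := by
  let e : (ι → Bool) ≃ (ι → Bool) :=
    ⟨fun ε i => !ε i, fun ε i => !ε i, fun ε => by simp, fun ε => by simp⟩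
  exact e.sum_comp F

end flip

variable {ι : Type*} [DecidableEq ι] [Fintype ι]
variable {V : Type*} [NormedAddCommGroup V] [NormedSpace ℝ V]

def cd (ι : Type*) [DecidableEq ι] [Fintype ι] : ℝ := (Fintype.card (ι → Bool) : ℝ)

lemma cd_pos : 0 < cd ι := by
  unfold cd; exact_mod_cast Fintype.card_pos

noncomputable def Q2 (x : ι → V) (A : Finset ι) : ℝ :=
  (cd ι)⁻¹ * ∑ ε : ι → Bool, ‖∑ i ∈ A, sg (ε i) • x i‖ ^ 2

lemma Q2_nonneg (x : ι → V) (A : Finset ι) : 0 ≤ Q2 x A := by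
  unfold Q2
  have := cd_pos (ι := ι)
  positivity

lemma sum_sq_rademacher (t : ι → ℝ) (A : Finset ι) :
    ∑ ε : ι → Bool, (∑ i ∈ A, sg (ε i) * t i) ^ 2 = cd ι * ∑ i ∈ A, t i ^ 2 := by
  induction A using Finset.induction_on with
  | empty => simp
  | insert a A ha ih =>
    have h0 : ∑ ε : ι → Bool, sg (ε a) * t a * (∑ i ∈ A, sg (ε i) * t i) = 0 := by
      have h := sum_flip a (fun ε => sg (ε a) * t a * (∑ i ∈ A, sg (ε i) * t i))
      have h2 : ∀ ε : ι → Bool, sg (flipAt a ε a) * t a * (∑ i ∈ A, sg (flipAt a ε i) * t i)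
          = - (sg (ε a) * t a * (∑ i ∈ A, sg (ε i) * t i)) := by
        intro ε
        rw [flipAt_same, sg_not]
        have : ∑ i ∈ A, sg (flipAt a ε i) * t i = ∑ i ∈ A, sg (ε i) * t i := by
          apply Finset.sum_congr rfl
          intro i hi
          rw [flipAt_ne (by rintro rfl; exact ha hi)]
        rw [this]; ring
      simp only [h2, Finset.sum_neg_distrib] at h
      linarith
    have h1 : ∀ ε : ι → Bool, (∑ i ∈ insert a A, sg (ε i) * t i) ^ 2 =
        t a ^ 2 + 2 * (sg (ε a) * t a * (∑ i ∈ A, sg (ε i) * t i))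
          + (∑ i ∈ A, sg (ε i) * t i) ^ 2 := by
      intro ε
      rw [Finset.sum_insert ha]
      linear_combination (t a ^ 2) * sg_sq (ε a)
    rw [Finset.sum_congr rfl (fun ε _ => h1 ε), Finset.sum_add_distrib, Finset.sum_add_distrib,
      ← Finset.mul_sum, h0, ih, Finset.sum_insert ha]
    simp [cd]
    ring

lemma sum_sq_le_Q2 (x : ι → V) (A : Finset ι) (f : V →L[ℝ] ℝ) (hf : ‖f‖ ≤ 1) :
    ∑ i ∈ A, (f (x i)) ^ 2 ≤ Q2 x A := by
  have h := sum_sq_rademacher (fun i => f (x i)) A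
  have hc := cd_pos (ι := ι)
  unfold Q2
  rw [inv_mul_eq_div, le_div_iff₀ hc, mul_comm, ← h]
  apply Finset.sum_le_sum
  intro ε _
  have : ∑ i ∈ A, sg (ε i) * f (x i) = f (∑ i ∈ A, sg (ε i) • x i) := by simp
  rw [this, ← sq_abs]
  have h2 := f.le_of_opNorm_le hf (∑ i ∈ A, sg (ε i) • x i)
  rw [one_mul, Real.norm_eq_abs] at h2
  gcongr

lemma norm_sq_le_Q2 (x : ι → V) (A : Finset ι) {i : ι} (hi : i ∈ A) :
    ‖x i‖ ^ 2 ≤ Q2 x A := by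
  obtain ⟨f, hf, hx⟩ := exists_dual_vector'' ℝ (x i)
  have h := sum_sq_le_Q2 x A f hf
  have h2 : (f (x i)) ^ 2 ≤ ∑ i ∈ A, (f (x i)) ^ 2 :=
    Finset.single_le_sum (f := fun i => (f (x i)) ^ 2) (fun _ _ => sq_nonneg _) hi
  rw [hx] at h2
  exact h2.trans h

lemma mean_le_sqrt_Q2 (x : ι → V) (A : Finset ι) :
    ∑ ε : ι → Bool, ‖∑ i ∈ A, sg (ε i) • x i‖ ≤ cd ι * √(Q2 x A) := by
  have hc := cd_pos (ι := ι)
  have h := sq_sum_le_card_mul_sum_sq (s := (Finset.univ : Finset (ι → Bool)))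
    (f := fun ε => ‖∑ i ∈ A, sg (ε i) • x i‖)
  have h1 : ∑ ε : ι → Bool, ‖∑ i ∈ A, sg (ε i) • x i‖ ^ 2 = cd ι * Q2 x A := by
    unfold Q2; field_simp
  rw [h1] at h
  refine (sq_le_sq₀ (by positivity) (by positivity)).1 ?_
  rw [mul_pow, Real.sq_sqrt (Q2_nonneg x A)]
  refine h.trans (le_of_eq ?_)
  simp [cd]; ring
end GapProof

namespace GapProof
variable {ι : Type*} [DecidableEq ι] [Fintype ι]
variable {V : Type*} [NormedAddCommGroup V] [NormedSpace ℝ V]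

/-- one coordinate of the contraction principle -/
lemma contraction_one {T : Type*} [Nonempty T] (i : ι) (h : T → (ι → Bool) → ℝ) (t : T → ℝ)
    (hflip : ∀ s ε, h s (flipAt i ε) = h s ε)
    (hb : ∀ ε, BddAbove (Set.range fun s => h s ε + sg (ε i) * t s)) :
    ∑ ε, (⨆ s, (h s ε + sg (ε i) * |t s|)) ≤ ∑ ε, (⨆ s, (h s ε + sg (ε i) * t s)) := by
  set F : (ι → Bool) → ℝ := fun ε => ⨆ s, (h s ε + sg (ε i) * |t s|) with hF
  set G : (ι → Bool) → ℝ := fun ε => ⨆ s, (h s ε + sg (ε i) * t s) with hG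
  have key : ∀ ε, ε i = true → F ε + F (flipAt i ε) ≤ G ε + G (flipAt i ε) := by
    intro ε hε
    have g1 : ∀ s, h s ε + t s ≤ G ε := fun s => by
      have := le_ciSup (hb ε) s
      simpa [hG, hε, sg] using this
    have g2 : ∀ s, h s ε - t s ≤ G (flipAt i ε) := fun s => by
      have := le_ciSup (hb (flipAt i ε)) s
      simpa [hG, hε, sg, flipAt_same, hflip, sub_eq_add_neg] using this
    have h1 : F ε = ⨆ s, (h s ε + |t s|) := by simp [hF, hε, sg]
    have h2 : F (flipAt i ε) = ⨆ s, (h s ε - |t s|) := by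
      simp [hF, hε, sg, flipAt_same, hflip, sub_eq_add_neg]
    rw [h1, h2, ← le_sub_iff_add_le]
    apply ciSup_le
    intro s
    rw [le_sub_iff_add_le, add_comm, ← le_sub_iff_add_le]
    apply ciSup_le
    intro u
    rw [le_sub_iff_add_le]
    have a1 := g1 s; have a2 := g2 s; have b1 := g1 u; have b2 := g2 u
    rcases abs_cases (t s) with ⟨e, _⟩ | ⟨e, _⟩ <;> rcases abs_cases (t u) with ⟨e', _⟩ | ⟨e', _⟩ <;>
      rw [e, e'] <;> linarith
  have key' : ∀ ε, F ε + F (flipAt i ε) ≤ G ε + G (flipAt i ε) := by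
    intro ε
    cases hε : ε i
    · have := key (flipAt i ε) (by simp [flipAt_same, hε])
      rw [flipAt_flipAt] at this
      linarith
    · exact key ε hε
  have hs := Finset.sum_le_sum (fun ε (_ : ε ∈ (Finset.univ : Finset (ι → Bool))) => key' ε)
  rw [Finset.sum_add_distrib, Finset.sum_add_distrib, sum_flip i F, sum_flip i G] at hs
  linarith

lemma contraction {T : Type*} [Nonempty T] (t : T → ι → ℝ) (C : ℝ) (hC : ∀ s i, |t s i| ≤ C)
    (A : Finset ι) :
    ∑ ε : ι → Bool, (⨆ s, ∑ i ∈ A, sg (ε i) * |t s i|)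
      ≤ ∑ ε : ι → Bool, (⨆ s, ∑ i ∈ A, sg (ε i) * t s i) := by
  have main : ∀ B : Finset ι, Disjoint A B →
      ∑ ε : ι → Bool, (⨆ s, ((∑ i ∈ B, sg (ε i) * t s i) + ∑ i ∈ A, sg (ε i) * |t s i|))
      ≤ ∑ ε : ι → Bool, (⨆ s, ((∑ i ∈ B, sg (ε i) * t s i) + ∑ i ∈ A, sg (ε i) * t s i)) := by
    induction A using Finset.induction_on with
    | empty => intro B _; simp
    | insert a A ha ih =>
      intro B hB
      rw [Finset.disjoint_insert_left] at hB
      have hb1 : ∀ (ε : ι → Bool) (s : T) i, sg (ε i) * t s i ≤ C := fun ε s i =>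
        (le_abs_self _).trans (by rw [abs_mul, abs_sg, one_mul]; exact hC s i)
      have hb2 : ∀ (ε : ι → Bool) (s : T) i, sg (ε i) * |t s i| ≤ C := fun ε s i =>
        (le_abs_self _).trans (by rw [abs_mul, abs_sg, one_mul, abs_abs]; exact hC s i)
      have h1 := contraction_one a
        (fun s ε => (∑ i ∈ B, sg (ε i) * t s i) + ∑ i ∈ A, sg (ε i) * |t s i|) (fun s => t s a)
        (by
          intro s ε
          congr 1
          · apply Finset.sum_congr rfl
            intro i hi
            rw [flipAt_ne (by rintro rfl; exact hB.1 hi)]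
          · apply Finset.sum_congr rfl
            intro i hi
            rw [flipAt_ne (by rintro rfl; exact ha hi)])
        (by
          intro ε
          refine ⟨(∑ i ∈ B, C) + (∑ i ∈ A, C) + C, ?_⟩
          rintro _ ⟨s, rfl⟩
          exact add_le_add (add_le_add (Finset.sum_le_sum fun i _ => hb1 ε s i)
            (Finset.sum_le_sum fun i _ => hb2 ε s i)) (hb1 ε s a))
      have h2 := ih (insert a B) (by
        rw [Finset.disjoint_insert_right]; exact ⟨ha, hB.2⟩)
      simp only [Finset.sum_insert ha, Finset.sum_insert hB.1] at h2 ⊢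
      calc _ = ∑ ε : ι → Bool, (⨆ s, ((∑ i ∈ B, sg (ε i) * t s i) +
                ∑ i ∈ A, sg (ε i) * |t s i| + sg (ε a) * |t s a|)) := by
            simp only [add_assoc, add_comm, add_left_comm]
        _ ≤ _ := h1
        _ = ∑ ε : ι → Bool, (⨆ s, (sg (ε a) * t s a + (∑ i ∈ B, sg (ε i) * t s i) +
                ∑ i ∈ A, sg (ε i) * |t s i|)) := by
            simp only [add_assoc, add_comm, add_left_comm]
        _ ≤ _ := h2
        _ = _ := by simp only [add_assoc, add_comm, add_left_comm]
  simpa using main ∅ (by simp)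

/-- weak `ℓ₁` bound -/
def Wk (x : ι → V) (A : Finset ι) (c : ℝ) : Prop :=
  ∀ f : V →L[ℝ] ℝ, ‖f‖ ≤ 1 → ∑ i ∈ A, |f (x i)| ≤ c

lemma halving (x : ι → V) (A : Finset ι) (n : ℕ) (hA : A.card = 2 * n) (c : ℝ) (hc : Wk x A c) :
    ∃ A' ⊆ A, A'.card = n ∧ Wk x A' (c / 2 + √(Q2 x A)) := by
  let T := {f : V →L[ℝ] ℝ // ‖f‖ ≤ 1}
  have : Nonempty T := ⟨⟨0, by simp⟩⟩
  have hbd : ∀ (f : T) i, |f.1 (x i)| ≤ ‖x i‖ := fun f i => by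
    have := f.1.le_of_opNorm_le f.2 (x i)
    simpa using this
  have hbd' : ∀ (f : T) i, |f.1 (x i)| ≤ ∑ j, ‖x j‖ := fun f i =>
    (hbd f i).trans (Finset.single_le_sum (f := fun j => ‖x j‖)
      (fun _ _ => norm_nonneg _) (Finset.mem_univ i))
  have h1 := contraction (fun (f : T) i => f.1 (x i)) _ hbd' A
  set S : (ι → Bool) → ℝ := fun ε => ⨆ f : T, ∑ i ∈ A, sg (ε i) * |f.1 (x i)| with hS
  have hSb : ∀ ε : ι → Bool, BddAbove (Set.range fun f : T => ∑ i ∈ A, sg (ε i) * |f.1 (x i)|) := by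
    intro ε
    refine ⟨∑ i ∈ A, ‖x i‖, ?_⟩
    rintro _ ⟨f, rfl⟩
    apply Finset.sum_le_sum
    intro i _
    refine (le_abs_self _).trans ?_
    rw [abs_mul, abs_sg, one_mul, abs_abs]
    exact hbd f i
  have hS0 : ∀ ε, 0 ≤ S ε := by
    intro ε
    have := le_ciSup (hSb ε) ⟨0, by simp⟩
    simpa using this
  have h2 : ∑ ε : ι → Bool, (⨆ f : T, ∑ i ∈ A, sg (ε i) * f.1 (x i))
      ≤ ∑ ε : ι → Bool, ‖∑ i ∈ A, sg (ε i) • x i‖ := by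
    apply Finset.sum_le_sum
    intro ε _
    apply ciSup_le
    intro f
    have : ∑ i ∈ A, sg (ε i) * f.1 (x i) = f.1 (∑ i ∈ A, sg (ε i) • x i) := by simp
    rw [this]
    refine (le_abs_self _).trans ?_
    simpa using f.1.le_of_opNorm_le f.2 (∑ i ∈ A, sg (ε i) • x i)
  have h3 := (h1.trans h2).trans (mean_le_sqrt_Q2 x A)
  have h4 : ∑ ε, (S ε + S (fun i => !ε i)) ≤ ∑ ε : ι → Bool, 2 * √(Q2 x A) := by
    rw [Finset.sum_add_distrib, sum_not S]
    simp only [Finset.sum_const, nsmul_eq_mul, Finset.card_univ]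
    change _ ≤ cd ι * _
    linarith
  obtain ⟨ε, -, hε⟩ := Finset.exists_le_of_sum_le (Finset.univ_nonempty) h4
  have fin : ∀ ε : ι → Bool, S ε ≤ 2 * √(Q2 x A) → n ≤ (A.filter (fun i => ε i = true)).card →
      ∃ A' ⊆ A, A'.card = n ∧ Wk x A' (c / 2 + √(Q2 x A)) := by
    intro ε h5 h6
    obtain ⟨A', hA', hn⟩ := Finset.exists_subset_card_eq h6
    refine ⟨A', hA'.trans (Finset.filter_subset _ _), hn, ?_⟩
    intro f hf
    have h7 := hc f hf
    have h8 : ∑ i ∈ A, sg (ε i) * |f (x i)| ≤ S ε := le_ciSup (hSb ε) ⟨f, hf⟩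
    have h9 : ∑ i ∈ A', |f (x i)| ≤ ∑ i ∈ A.filter (fun i => ε i = true), |f (x i)| :=
      Finset.sum_le_sum_of_subset_of_nonneg hA' (fun _ _ _ => abs_nonneg _)
    have h10 : ∑ i ∈ A.filter (fun i => ε i = true), |f (x i)| =
        (1/2) * (∑ i ∈ A, |f (x i)| + ∑ i ∈ A, sg (ε i) * |f (x i)|) := by
      rw [Finset.sum_filter, ← Finset.sum_add_distrib, Finset.mul_sum]
      apply Finset.sum_congr rfl
      intro i _
      cases ε i <;> simp [sg]
      ring
    linarith
  have hsum : (A.filter (fun i => ε i = true)).card + (A.filter (fun i => (!ε i) = true)).card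
      = 2 * n := by
    rw [← hA, ← Finset.card_filter_add_card_filter_not (s := A) (fun i => ε i = true)]
    simp
  by_cases h : n ≤ (A.filter (fun i => ε i = true)).card
  · exact fin ε (by linarith [hS0 (fun i => !ε i)]) h
  · exact fin (fun i => !ε i) (by linarith [hS0 ε]) (by omega)

lemma iterate_halving (x : ι → V) (K : ℕ) (S : Finset ι) (hK : S.card = 2 ^ K) (α D w : ℝ) (hD : 0 ≤ D)
    (hα : α ≤ 1 / 2)
    (hR : ∀ A ⊆ S, √(Q2 x A) ≤ D * (A.card : ℝ) ^ α) (hw : Wk x S w) (k : ℕ) (hk : k ≤ K) :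
    ∃ A ⊆ S, A.card = 2 ^ (K - k) ∧
      Wk x A (w / 2 ^ k + 5 * D * ((2 : ℝ) ^ (K - k)) ^ α) := by
  induction k with
  | zero =>
    refine ⟨S, subset_rfl, by simpa using hK, ?_⟩
    intro f hf
    refine (hw f hf).trans ?_
    simp; positivity
  | succ k ih =>
    obtain ⟨A, hAS, hA, hW⟩ := ih (by omega)
    have e : K - k = (K - (k + 1)) + 1 := by omega
    obtain ⟨A', hAA', hA', hW'⟩ := halving x A (2 ^ (K - (k+1))) (by rw [hA, e, pow_succ]; ring) _ hW
    refine ⟨A', hAA'.trans hAS, hA', ?_⟩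
    intro f hf
    refine (hW' f hf).trans ?_
    have h1 := hR A hAS
    rw [hA] at h1
    push_cast at h1
    have h2 : ((2:ℝ) ^ (K - k)) ^ α ≤ 1.42 * ((2:ℝ) ^ (K - (k+1))) ^ α := by
      rw [e, pow_succ, mul_comm, Real.mul_rpow (by norm_num) (by positivity)]
      gcongr
      calc (2:ℝ) ^ α ≤ (2:ℝ) ^ (1/2 : ℝ) := Real.rpow_le_rpow_of_exponent_le (by norm_num) hα
        _ ≤ 1.42 := by
          rw [← Real.sqrt_eq_rpow, Real.sqrt_le_left (by norm_num)]; norm_num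
    have h3 := mul_le_mul_of_nonneg_left h2 hD
    have h4 : w / 2 ^ (k + 1) = w / 2 ^ k / 2 := by rw [pow_succ]; field_simp
    rw [h4]
    have h5 : 0 ≤ D * ((2:ℝ) ^ (K - (k+1))) ^ α := by positivity
    nlinarith

/-- from averages to suprema -/
lemma weak_of_avg (α D : ℝ) (hD : 0 ≤ D) (hα0 : 0 ≤ α) (hα : α < 1 / 2) (m K : ℕ)
    (hKm : m ≤ K) (hK : (m : ℝ) ≤ (1 / 2 - α) * K)
    (x : ι → V) (S : Finset ι) (hc : S.card = 2 ^ K)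
    (hR : ∀ A ⊆ S, √(Q2 x A) ≤ D * (A.card : ℝ) ^ α) :
    ∃ A ⊆ S, A.card = 2 ^ m ∧ Wk x A (6 * D * ((2 : ℝ) ^ m) ^ α) := by
  have hw : Wk x S (√(2 ^ K) * (D * ((2:ℝ) ^ K) ^ α)) := by
    intro f hf
    have h1 := sum_sq_le_Q2 x S f hf
    have h2 := sq_sum_le_card_mul_sum_sq (s := S) (f := fun i => |f (x i)|)
    simp only [sq_abs, hc] at h2
    have h3 := hR S subset_rfl
    rw [hc] at h3
    push_cast at h2 h3
    refine le_trans ?_ (mul_le_mul_of_nonneg_left h3 (by positivity))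
    rw [← Real.sqrt_mul (by positivity)]
    apply Real.le_sqrt_of_sq_le
    refine h2.trans ?_
    gcongr
  obtain ⟨A, hAS, hA, hW⟩ := iterate_halving x K S hc α D _ hD hα.le hR hw (K - m) (by omega)
  rw [show K - (K - m) = m by omega] at hA hW
  refine ⟨A, hAS, hA, fun f hf => (hW f hf).trans ?_⟩
  have h1 : √(2 ^ K) * (D * ((2:ℝ) ^ K) ^ α) / 2 ^ (K - m) ≤ D := by
    rw [div_le_iff₀ (by positivity)]
    have e1 : √((2:ℝ) ^ K) = (2:ℝ) ^ ((K:ℝ) * (1/2)) := by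
      rw [Real.sqrt_eq_rpow, ← Real.rpow_natCast, ← Real.rpow_mul (by norm_num)]
    have e2 : ((2:ℝ) ^ K) ^ α = (2:ℝ) ^ ((K:ℝ) * α) := by
      rw [← Real.rpow_natCast, ← Real.rpow_mul (by norm_num)]
    have e3 : (2:ℝ) ^ (K - m) = (2:ℝ) ^ ((K:ℝ) - m) := by
      rw [← Real.rpow_natCast, Nat.cast_sub hKm]
    rw [e1, e2, e3, mul_left_comm, ← Real.rpow_add (by norm_num)]
    gcongr
    · norm_num
    · linarith
  have h2 : 1 ≤ ((2:ℝ) ^ m) ^ α := Real.one_le_rpow (one_le_pow₀ (by norm_num)) hα0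
  nlinarith
end GapProof

namespace GapProof
variable {ι : Type*} [DecidableEq ι] [Fintype ι]
variable {V : Type*} [NormedAddCommGroup V] [NormedSpace ℝ V]

lemma minkowski_aux {E J : Type*} [Fintype E] [Fintype J] (r B : ℝ) (hr : 1 ≤ r)
    (a : E → J → ℝ) (b : E → ℝ) (ha : ∀ e j, 0 ≤ a e j) (hb : ∀ e, 0 ≤ b e)
    (h : ∀ e, ∑ j, a e j ^ r ≤ B * b e ^ r) :
    ∑ j, (∑ e, a e j) ^ r ≤ B * (∑ e, b e) ^ r := by
  have hr0 : r ≠ 0 := by linarith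
  have hzero : ∀ e, b e = 0 → ∀ j, a e j = 0 := by
    intro e he j
    have h1 := h e
    rw [he, Real.zero_rpow hr0, mul_zero] at h1
    have h2 : a e j ^ r ≤ 0 := (Finset.single_le_sum (f := fun j => a e j ^ r)
      (fun j _ => Real.rpow_nonneg (ha e j) r) (Finset.mem_univ j)).trans h1
    have h3 : a e j ^ r = 0 := le_antisymm h2 (Real.rpow_nonneg (ha e j) r)
    exact ((Real.rpow_eq_zero (ha e j) hr0).1 h3)
  set S := ∑ e, b e with hS
  have hS0 : 0 ≤ S := Finset.sum_nonneg fun e _ => hb e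
  rcases hS0.eq_or_lt with h0 | hpos
  · have hb0 : ∀ e, b e = 0 := fun e =>
      (Finset.sum_eq_zero_iff_of_nonneg (fun e _ => hb e)).1 h0.symm e (Finset.mem_univ e)
    have : ∀ e j, a e j = 0 := fun e j => hzero e (hb0 e) j
    simp [this, ← h0, Real.zero_rpow hr0]
  · have h1 : ∀ j, (∑ e, a e j) ^ r ≤ ∑ e, (b e / S) * (S * a e j / b e) ^ r := by
      intro j
      have := Real.rpow_arith_mean_le_arith_mean_rpow Finset.univ (fun e => b e / S)
        (fun e => S * a e j / b e) (fun e _ => div_nonneg (hb e) hS0)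
        (by rw [← Finset.sum_div, ← hS, div_self hpos.ne'])
        (fun e _ => div_nonneg (mul_nonneg hS0 (ha e j)) (hb e)) hr
      refine le_trans (le_of_eq ?_) this
      congr 1
      apply Finset.sum_congr rfl
      intro e _
      by_cases he : b e = 0
      · simp [he, hzero e he j]
      · field_simp
    calc ∑ j, (∑ e, a e j) ^ r ≤ ∑ j, ∑ e, (b e / S) * (S * a e j / b e) ^ r :=
          Finset.sum_le_sum fun j _ => h1 j
      _ = ∑ e, ∑ j, (b e / S) * (S * a e j / b e) ^ r := Finset.sum_comm
      _ ≤ ∑ e, (b e / S) * (B * S ^ r) := by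
          apply Finset.sum_le_sum
          intro e _
          rw [← Finset.mul_sum]
          by_cases he : b e = 0
          · simp [he]
          · have hbe : 0 < b e := lt_of_le_of_ne (hb e) (Ne.symm he)
            apply mul_le_mul_of_nonneg_left _ (div_nonneg (hb e) hS0)
            have : ∀ j, (S * a e j / b e) ^ r = (S ^ r / b e ^ r) * a e j ^ r := by
              intro j
              rw [Real.div_rpow (mul_nonneg hS0 (ha e j)) (hb e), Real.mul_rpow hS0 (ha e j)]
              ring
            simp only [this, ← Finset.mul_sum]
            have hbr : 0 < b e ^ r := Real.rpow_pos_of_pos hbe r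
            calc S ^ r / b e ^ r * ∑ j, a e j ^ r ≤ S ^ r / b e ^ r * (B * b e ^ r) := by
                  apply mul_le_mul_of_nonneg_left (h e) (by positivity)
              _ = B * S ^ r := by field_simp
      _ = B * S ^ r := by
          rw [← Finset.sum_mul, ← Finset.sum_div, ← hS, div_self hpos.ne', one_mul]

lemma beq_beq_self (a b : Bool) : ((a == b) == b) = a := by cases a <;> cases b <;> rfl

lemma sg_beq (a b : Bool) : sg (a == b) = sg b * sg a := by cases a <;> cases b <;> simp [sg]

lemma block (p B : ℝ) (hp : 2 ≤ p) (hB : ∀ y : ι → V, ∑ i, ‖y i‖ ^ p ≤ B * (Q2 y univ) ^ (p / 2))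
    (x : ι → V) (c : ι → ι) :
    ∑ j, (Q2 x (univ.filter fun i => c i = j)) ^ (p / 2) ≤ B * (Q2 x univ) ^ (p / 2) := by
  have hc := cd_pos (ι := ι)
  let y : (ι → Bool) → ι → V := fun ε j => ∑ i ∈ univ.filter (fun i => c i = j), sg (ε i) • x i
  have hbsum : ∑ ε : ι → Bool, Q2 (y ε) univ = cd ι * Q2 x univ := by
    have e1 : ∀ ε' : ι → Bool, ∑ ε : ι → Bool, ‖∑ j, sg (ε' j) • y ε j‖ ^ 2
        = cd ι * Q2 x univ := by
      intro ε'
      let e : (ι → Bool) ≃ (ι → Bool) :=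
        ⟨fun ε i => (ε i == ε' (c i)), fun ε i => (ε i == ε' (c i)),
          fun ε => by funext i; exact beq_beq_self _ _,
          fun ε => by funext i; exact beq_beq_self _ _⟩
      have e2 : ∀ ε, ∑ j, sg (ε' j) • y ε j = ∑ i, sg (e ε i) • x i := by
        intro ε
        have : ∀ j, sg (ε' j) • y ε j =
            ∑ i ∈ univ.filter (fun i => c i = j), sg (e ε i) • x i := by
          intro j
          simp only [y, Finset.smul_sum]
          apply Finset.sum_congr rfl
          intro i hi
          rw [Finset.mem_filter] at hi
          change _ = sg (ε i == ε' (c i)) • x i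
          rw [sg_beq, hi.2, smul_smul]
        simp only [this]
        exact Finset.sum_fiberwise _ _ _
      simp only [e2]
      rw [e.sum_comp (fun ε => ‖∑ i, sg (ε i) • x i‖ ^ 2)]
      unfold Q2
      field_simp
    unfold Q2 at *
    rw [← Finset.mul_sum, Finset.sum_comm, Finset.sum_congr rfl (fun ε' _ => e1 ε')]
    simp only [Finset.sum_const, nsmul_eq_mul, Finset.card_univ]
    change (cd ι)⁻¹ * (cd ι * _) = _
    field_simp
  have hm := minkowski_aux (p / 2) B (by linarith) (fun ε j => ‖y ε j‖ ^ 2)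
    (fun ε => Q2 (y ε) univ) (fun _ _ => by positivity) (fun ε => Q2_nonneg _ _)
    (by
      intro ε
      refine le_trans (le_of_eq ?_) (hB (y ε))
      apply Finset.sum_congr rfl
      intro j _
      rw [← Real.rpow_natCast, ← Real.rpow_mul (norm_nonneg _)]
      congr 1
      push_cast
      ring)
  rw [hbsum] at hm
  have e3 : ∀ j, (∑ ε, ‖y ε j‖ ^ 2) = cd ι * Q2 x (univ.filter fun i => c i = j) := by
    intro j
    unfold Q2
    simp only [y]
    field_simp
  simp only [e3] at hm
  simp only [Real.mul_rpow hc.le (Q2_nonneg _ _)] at hm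
  rw [← Finset.mul_sum, mul_left_comm] at hm
  exact le_of_mul_le_mul_left hm (Real.rpow_pos_of_pos hc _)

lemma norm_rpow_le_Q2 (p : ℝ) (hp : 2 ≤ p) (x : ι → V) (A : Finset ι) {i : ι} (hi : i ∈ A) :
    ‖x i‖ ^ p ≤ (Q2 x A) ^ (p / 2) := by
  have h := norm_sq_le_Q2 x A hi
  calc ‖x i‖ ^ p = (‖x i‖ ^ 2) ^ (p / 2) := by
        rw [← Real.rpow_natCast, ← Real.rpow_mul (norm_nonneg _)]
        congr 1
        push_cast; ring
    _ ≤ _ := Real.rpow_le_rpow (by positivity) h (by linarith)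

lemma leftover (p : ℝ) (hp : 2 ≤ p) (x : ι → V) (N : ℕ) (n : ℕ) : ∀ (L : Finset ι), L.card ≤ n →
    ∀ (m : ℝ), 0 ≤ m →
    (∀ t : ℝ, 0 < t → (L.filter (fun i => t < ‖x i‖ ∧ ‖x i‖ ≤ 2 * t)).card ≤ N) →
    (∀ i ∈ L, ‖x i‖ ≤ m) → ∑ i ∈ L, ‖x i‖ ^ p ≤ 2 * N * m ^ p := by
  induction n with
  | zero =>
    intro L hL m hm _ _
    have : L = ∅ := by simpa using hL
    subst this
    simp; positivity
  | succ n ih =>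
    intro L hL m hm hN hLm
    rcases L.eq_empty_or_nonempty with rfl | hne
    · simp; positivity
    obtain ⟨i0, hi0, hmax⟩ := Finset.exists_max_image L (fun i => ‖x i‖) hne
    set m' := ‖x i0‖ with hm'
    have hm'm : m' ≤ m := hLm i0 hi0
    rcases (norm_nonneg (x i0)).eq_or_lt with h0 | hpos
    · have : ∀ i ∈ L, ‖x i‖ ^ p = 0 := by
        intro i hi
        have h1 : ‖x i‖ = 0 := le_antisymm ((hmax i hi).trans h0.symm.le) (norm_nonneg _)
        rw [h1, Real.zero_rpow (by linarith)]
      rw [Finset.sum_eq_zero this]; positivity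
    · have hfil : L.filter (fun i => m' / 2 < ‖x i‖) =
          L.filter (fun i => m' / 2 < ‖x i‖ ∧ ‖x i‖ ≤ 2 * (m' / 2)) := by
        apply Finset.filter_congr
        intro i hi
        have := hmax i hi
        constructor
        · intro h; exact ⟨h, by linarith⟩
        · intro h; exact h.1
      have h1 : ∑ i ∈ L.filter (fun i => m' / 2 < ‖x i‖), ‖x i‖ ^ p ≤ N * m' ^ p := by
        have hcard := hN (m' / 2) (by linarith)
        rw [← hfil] at hcard
        calc _ ≤ ∑ i ∈ L.filter (fun i => m' / 2 < ‖x i‖), m' ^ p := by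
              apply Finset.sum_le_sum
              intro i hi
              exact Real.rpow_le_rpow (norm_nonneg _) (hmax i (Finset.mem_filter.1 hi).1)
                (by linarith)
          _ ≤ _ := by
              rw [Finset.sum_const, nsmul_eq_mul]
              gcongr
      have h2 := ih (L.filter (fun i => ¬ m' / 2 < ‖x i‖)) (by
          have : (L.filter (fun i => ¬ m' / 2 < ‖x i‖)).card < L.card := by
            apply Finset.card_lt_card
            refine ⟨Finset.filter_subset _ _, fun h => ?_⟩
            have := (Finset.mem_filter.1 (h hi0)).2
            apply this
            change m' / 2 < m'
            linarith
          omega) (m' / 2) (by linarith) (by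
          intro t ht
          refine (Finset.card_le_card ?_).trans (hN t ht)
          exact Finset.filter_subset_filter _ (Finset.filter_subset _ _)) (by
          intro i hi
          exact not_lt.1 (Finset.mem_filter.1 hi).2)
      rw [← Finset.sum_filter_add_sum_filter_not L (fun i => m' / 2 < ‖x i‖)]
      have h3 : (m' / 2) ^ p ≤ m' ^ p / 4 := by
        rw [Real.div_rpow (by linarith) (by norm_num)]
        have : (4:ℝ) ≤ 2 ^ p := by
          calc (4:ℝ) = 2 ^ (2:ℝ) := by norm_num
            _ ≤ _ := Real.rpow_le_rpow_of_exponent_le (by norm_num) hp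
        gcongr
      have h4 : m' ^ p ≤ m ^ p := Real.rpow_le_rpow hpos.le hm'm (by linarith)
      have hN0 : (0:ℝ) ≤ N := Nat.cast_nonneg N
      have h5 : 0 ≤ m' ^ p := by positivity
      nlinarith [mul_le_mul_of_nonneg_left h3 hN0, mul_le_mul_of_nonneg_left h4 hN0,
        mul_nonneg hN0 h5]

def Good (p : ℝ) (x : ι → V) (A : Finset ι) : Prop :=
  4 * ∑ i ∈ A, ‖x i‖ ^ p ≤ (Q2 x A) ^ (p / 2)

lemma greedy (p : ℝ) (x : ι → V) (N : ℕ)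
    (hbad : ∀ S : Finset ι, S.card = N → ∀ t : ℝ, 0 < t →
      (∀ i ∈ S, t < ‖x i‖ ∧ ‖x i‖ ≤ 2 * t) → ∃ A ⊆ S, A.Nonempty ∧ Good p x A) :
    ∃ (U : Finset ι) (c : ι → ι), (∀ i ∈ U, c i ∈ U) ∧ (∀ i ∉ U, c i = i) ∧
      (∀ j ∈ U, Good p x (univ.filter fun i => c i = j) ∨ ∀ i, c i ≠ j) ∧
      (∀ t : ℝ, 0 < t → (Uᶜ.filter (fun i => t < ‖x i‖ ∧ ‖x i‖ ≤ 2 * t)).card ≤ N) := by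
  classical
  let P : Finset ι → Prop := fun U => ∃ c : ι → ι, (∀ i ∈ U, c i ∈ U) ∧ (∀ i ∉ U, c i = i) ∧
      (∀ j ∈ U, Good p x (univ.filter fun i => c i = j) ∨ ∀ i, c i ≠ j)
  have hne : ((univ : Finset (Finset ι)).filter P).Nonempty := by
    refine ⟨∅, ?_⟩
    simp only [Finset.mem_filter, Finset.mem_univ, true_and]
    exact ⟨id, by simp, by simp, by simp⟩
  obtain ⟨U, hU, hmax⟩ := Finset.exists_max_image _ Finset.card hne
  obtain ⟨c, h1, h2, h3⟩ := (Finset.mem_filter.1 hU).2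
  refine ⟨U, c, h1, h2, h3, ?_⟩
  intro t ht
  by_contra hcon
  push Not at hcon
  obtain ⟨S, hS, hSN⟩ := Finset.exists_subset_card_eq hcon.le
  obtain ⟨A, hAS, ⟨i0, hi0⟩, hgood⟩ := hbad S hSN t ht (fun i hi => (Finset.mem_filter.1 (hS hi)).2)
  have hAU : ∀ i ∈ A, i ∉ U := fun i hi => by
    have := (Finset.mem_filter.1 (hS (hAS hi))).1
    simpa using this
  have hP : P (U ∪ A) := by
    refine ⟨fun i => if i ∈ A then i0 else c i, ?_, ?_, ?_⟩
    · intro i hi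
      by_cases h : i ∈ A
      · simp [h, hi0]
      · simp only [h, if_false]
        rcases Finset.mem_union.1 hi with h' | h'
        · exact Finset.mem_union_left _ (h1 i h')
        · exact absurd h' h
    · intro i hi
      rw [Finset.mem_union, not_or] at hi
      simp [hi.2, h2 i hi.1]
    · intro j hj
      by_cases hjA : j ∈ A
      · by_cases hji : j = i0
        · left
          subst hji
          convert hgood using 1
          ext i
          simp only [Finset.mem_filter, Finset.mem_univ, true_and]
          constructor
          · intro h
            by_contra hiA
            rw [if_neg hiA] at h
            by_cases hiU : i ∈ U
            · exact hAU j hi0 (h ▸ h1 i hiU)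
            · rw [h2 i hiU] at h
              exact hiA (h ▸ hi0)
          · intro h; simp [h]
        · right
          intro i
          by_cases hiA : i ∈ A
          · simp only [hiA, if_true]; exact fun h => hji h.symm
          · simp only [hiA, if_false]
            intro h
            by_cases hiU : i ∈ U
            · exact hAU j hjA (h ▸ h1 i hiU)
            · rw [h2 i hiU] at h
              exact hiA (h ▸ hjA)
      · have hjU : j ∈ U := by
          rcases Finset.mem_union.1 hj with h' | h'
          · exact h'
          · exact absurd h' hjA
        have hji : i0 ≠ j := fun h => hjA (h ▸ hi0)
        have hAc : ∀ i ∈ A, c i ≠ j := by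
          intro i hi h
          rw [h2 i (hAU i hi)] at h
          exact hjA (h ▸ hi)
        rcases h3 j hjU with h | h
        · left
          convert h using 1
          ext i
          by_cases hiA : i ∈ A
          · simp [hiA, hji, hAc i hiA]
          · simp [hiA]
        · right
          intro i
          by_cases hiA : i ∈ A
          · simp [hiA, hji]
          · simp [hiA, h i]
  have := hmax (U ∪ A) (Finset.mem_filter.2 ⟨Finset.mem_univ _, hP⟩)
  have hlt : U.card < (U ∪ A).card := by
    apply Finset.card_lt_card
    refine ⟨Finset.subset_union_left, fun h => ?_⟩
    exact hAU i0 hi0 (h (Finset.mem_union_right _ hi0))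
  omega

lemma improve (p B : ℝ) (hp : 2 ≤ p) (hB : ∀ y : ι → V, ∑ i, ‖y i‖ ^ p ≤ B * (Q2 y univ) ^ (p / 2))
    (x : ι → V) (N : ℕ)
    (hbad : ∀ S : Finset ι, S.card = N → ∀ t : ℝ, 0 < t →
      (∀ i ∈ S, t < ‖x i‖ ∧ ‖x i‖ ≤ 2 * t) → ∃ A ⊆ S, A.Nonempty ∧ Good p x A) :
    ∑ i, ‖x i‖ ^ p ≤ (2 * N + B / 4) * (Q2 x univ) ^ (p / 2) := by
  obtain ⟨U, c, h1, h2, h3, h4⟩ := greedy p x N hbad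
  have hl := leftover p hp x N Uᶜ.card Uᶜ le_rfl (√(Q2 x univ)) (Real.sqrt_nonneg _) h4
    (fun i _ => Real.le_sqrt_of_sq_le (norm_sq_le_Q2 x univ (Finset.mem_univ i)))
  have e : √(Q2 x univ) ^ p = (Q2 x univ) ^ (p / 2) := by
    rw [Real.sqrt_eq_rpow, ← Real.rpow_mul (Q2_nonneg _ _)]; congr 1; ring
  rw [e] at hl
  have hb := block p B hp hB x c
  have hU : 4 * ∑ i ∈ U, ‖x i‖ ^ p ≤ ∑ j, (Q2 x (univ.filter fun i => c i = j)) ^ (p / 2) := by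
    have e1 : ∑ i ∈ U, ‖x i‖ ^ p = ∑ j ∈ U, ∑ i ∈ univ.filter (fun i => c i = j), ‖x i‖ ^ p := by
      rw [← Finset.sum_fiberwise_of_maps_to h1]
      apply Finset.sum_congr rfl
      intro j hj
      apply Finset.sum_congr _ (fun _ _ => rfl)
      ext i
      simp only [Finset.mem_filter, Finset.mem_univ, true_and, and_iff_right_iff_imp]
      intro h
      by_contra hi
      rw [h2 i hi] at h
      exact hi (h ▸ hj)
    rw [e1, Finset.mul_sum]
    calc _ ≤ ∑ j ∈ U, (Q2 x (univ.filter fun i => c i = j)) ^ (p / 2) := by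
          apply Finset.sum_le_sum
          intro j hj
          rcases h3 j hj with h | h
          · exact h
          · have : univ.filter (fun i => c i = j) = ∅ := by
              ext i; simp [h i]
            rw [this]
            simp only [Finset.sum_empty, mul_zero]
            exact Real.rpow_nonneg (Q2_nonneg _ _) _
      _ ≤ _ := Finset.sum_le_sum_of_subset_of_nonneg (Finset.subset_univ _)
          (fun _ _ _ => Real.rpow_nonneg (Q2_nonneg _ _) _)
  rw [← Finset.sum_add_sum_compl U]
  linarith

/-- If no good families exist then `X` has cotype `p`. -/
lemma uniform_bound (p : ℝ) (hp : 2 ≤ p) (N : ℕ)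
    (hbad : ∀ x : ι → V, ∀ S : Finset ι, S.card = N → ∀ t : ℝ, 0 < t →
      (∀ i ∈ S, t < ‖x i‖ ∧ ‖x i‖ ≤ 2 * t) → ∃ A ⊆ S, A.Nonempty ∧ Good p x A) (x : ι → V) :
    ∑ i, ‖x i‖ ^ p ≤ (4 * N + 1) * (Q2 x univ) ^ (p / 2) := by
  have h0 : ∀ y : ι → V, ∑ i, ‖y i‖ ^ p ≤ (Fintype.card ι : ℝ) * (Q2 y univ) ^ (p / 2) := by
    intro y
    calc _ ≤ ∑ i : ι, (Q2 y univ) ^ (p / 2) :=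
          Finset.sum_le_sum fun i _ => norm_rpow_le_Q2 p hp y univ (Finset.mem_univ i)
      _ = _ := by simp
  have hk : ∀ k : ℕ, ∀ y : ι → V, ∑ i, ‖y i‖ ^ p ≤
      (4 * N + (Fintype.card ι : ℝ) / 4 ^ k) * (Q2 y univ) ^ (p / 2) := by
    intro k
    induction k with
    | zero =>
      intro y
      refine (h0 y).trans ?_
      have := Real.rpow_nonneg (Q2_nonneg y univ) (p / 2)
      gcongr
      simp
    | succ k ih =>
      intro y
      refine (improve p _ hp ih y N (hbad y)).trans ?_
      have := Real.rpow_nonneg (Q2_nonneg y univ) (p / 2)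
      refine mul_le_mul_of_nonneg_right ?_ this
      rw [pow_succ, ← div_div]
      have : (0:ℝ) ≤ N := Nat.cast_nonneg N
      linarith
  obtain ⟨k, hk'⟩ := pow_unbounded_of_one_lt (Fintype.card ι : ℝ) (by norm_num : (1:ℝ) < 4)
  refine (hk k x).trans ?_
  have := Real.rpow_nonneg (Q2_nonneg x univ) (p / 2)
  gcongr
  rw [div_le_one (by positivity)]
  exact hk'.le
end GapProof

namespace GapProof

/-- families with small weak `ℓ₁` norm -/
def FamQ (X : Type*) [NormedAddCommGroup X] [NormedSpace ℝ X] (α : ℝ) : Prop :=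
  ∃ C : ℝ, 0 ≤ C ∧ ∀ m : ℕ, ∃ x : ℕ → X, (∀ i < 2 ^ m, 1 ≤ ‖x i‖) ∧
    ∀ f : X →L[ℝ] ℝ, ‖f‖ ≤ 1 → ∑ i ∈ range (2 ^ m), |f (x i)| ≤ C * ((2 : ℝ) ^ m) ^ α

/-- reindexing a family on a finset by `ℕ`, with scaling -/
lemma reindex {X : Type*} [NormedAddCommGroup X] [NormedSpace ℝ X] {ι : Type*}
    (x : ι → X) (A : Finset ι) (n : ℕ) (hA : A.card = n) (t c : ℝ) (ht : 0 < t)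
    (hx : ∀ i ∈ A, t ≤ ‖x i‖)
    (hW : ∀ f : X →L[ℝ] ℝ, ‖f‖ ≤ 1 → ∑ i ∈ A, |f (x i)| ≤ c * t) :
    ∃ y : ℕ → X, (∀ i < n, 1 ≤ ‖y i‖) ∧
      ∀ f : X →L[ℝ] ℝ, ‖f‖ ≤ 1 → ∑ i ∈ range n, |f (y i)| ≤ c := by
  subst hA
  let e := A.equivFin.symm
  refine ⟨fun i => if h : i < A.card then t⁻¹ • x (e ⟨i, h⟩) else 0, ?_, ?_⟩
  · intro i hi
    simp only [hi, dif_pos, norm_smul, norm_inv, Real.norm_eq_abs, abs_of_pos ht]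
    rw [inv_mul_eq_div, one_le_div ht]
    exact hx _ (e ⟨i, hi⟩).2
  · intro f hf
    have h1 : ∑ i ∈ range A.card, |f (if h : i < A.card then t⁻¹ • x (e ⟨i, h⟩) else 0)|
        = ∑ i : Fin A.card, t⁻¹ * |f (x (e i))| := by
      rw [Finset.sum_range]
      apply Finset.sum_congr rfl
      intro i _
      simp [abs_mul, abs_of_pos ht]
    rw [h1, ← Finset.mul_sum, e.sum_comp (fun i : A => |f (x i)|),
      Finset.sum_coe_sort A (fun i => |f (x i)|), inv_mul_eq_div, div_le_iff₀ ht]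
    exact hW f hf

variable {X : Type*} [NormedAddCommGroup X] [NormedSpace ℂ X]

lemma cotype_expr (N : ℕ) (x : Fin N → X) :
    (2 : ℝ) ^ (-(N : ℝ)) *
        ∑ ε : Fin N → Bool, ‖∑ n : Fin N, (if ε n then (1 : ℝ) else -1) • x n‖ ^ 2
      = Q2 x univ := by
  unfold Q2 cd
  congr 1
  · rw [Real.rpow_neg (by norm_num)]
    simp

lemma hasCotype_of_bound (p B : ℝ) (hp : 2 ≤ p) (hB : 0 < B)
    (h : ∀ N : ℕ, ∀ x : Fin N → X, ∑ i, ‖x i‖ ^ p ≤ B * (Q2 x univ) ^ (p / 2)) :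
    HasCotype X p := by
  refine ⟨B ^ (1 / p), by positivity, fun N x => ?_⟩
  rw [cotype_expr]
  have h0 := Q2_nonneg x univ
  calc _ ≤ (B * (Q2 x univ) ^ (p / 2)) ^ (1 / p) :=
        Real.rpow_le_rpow (by positivity) (h N x) (by positivity)
    _ = _ := by
        rw [Real.mul_rpow hB.le (by positivity), ← Real.rpow_mul h0]
        congr 2
        field_simp

lemma famQ_of_not_cotype (p : ℝ) (hp : 2 < p) (h : ¬ HasCotype X p) : FamQ X (1 / p) := by
  have step1 : ∀ N : ℕ, ∃ (M : ℕ) (x : Fin M → X) (S : Finset (Fin M)), S.card = N ∧ ∃ t : ℝ,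
      0 < t ∧ (∀ i ∈ S, t < ‖x i‖ ∧ ‖x i‖ ≤ 2 * t) ∧ ∀ A ⊆ S, A.Nonempty → ¬ Good p x A := by
    intro N
    by_contra hcon
    push Not at hcon
    apply h
    apply hasCotype_of_bound p (4 * N + 1) hp.le (by positivity)
    intro M x
    exact uniform_bound p hp.le N (fun x S hS t ht hx => hcon M x S hS t ht hx) x
  have hα : 1 / p < 1 / 2 := by
    apply one_div_lt_one_div_of_lt <;> linarith
  refine ⟨24, by norm_num, fun m => ?_⟩
  obtain ⟨K0, hK0⟩ := exists_nat_ge ((m : ℝ) / (1 / 2 - 1 / p))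
  set K := max m K0 with hK
  obtain ⟨M, x, S, hS, t, ht, hx, hA⟩ := step1 (2 ^ K)
  have hR : ∀ A ⊆ S, √(Q2 x A) ≤ (4 * t) * (A.card : ℝ) ^ (1 / p) := by
    intro A hAS
    rcases A.eq_empty_or_nonempty with rfl | hne
    · have : Q2 x ∅ = 0 := by simp [Q2]
      rw [this, Real.sqrt_zero]
      positivity
    have h1 := hA A hAS hne
    unfold Good at h1
    push Not at h1
    have h0 := Q2_nonneg x A
    have h2 : ∑ i ∈ A, ‖x i‖ ^ p ≤ A.card * (2 * t) ^ p := by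
      calc _ ≤ ∑ i ∈ A, (2 * t) ^ p := Finset.sum_le_sum fun i hi =>
            Real.rpow_le_rpow (norm_nonneg _) (hx i (hAS hi)).2 (by linarith)
        _ = _ := by simp
    have h3 : (4:ℝ) ≤ 2 ^ p := by
      calc (4:ℝ) = 2 ^ (2:ℝ) := by norm_num
        _ ≤ _ := Real.rpow_le_rpow_of_exponent_le (by norm_num) hp.le
    have h4 : (Q2 x A) ^ (p / 2) ≤ A.card * (4 * t) ^ p := by
      have : (4 * t) ^ p = 2 ^ p * (2 * t) ^ p := by
        rw [← Real.mul_rpow (by norm_num) (by positivity)]; ring_nf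
      rw [this]
      have h5 : 0 ≤ (A.card : ℝ) * (2 * t) ^ p := by positivity
      nlinarith
    calc √(Q2 x A) = ((Q2 x A) ^ (p / 2)) ^ (1 / p) := by
          rw [← Real.rpow_mul h0, Real.sqrt_eq_rpow]; congr 1; field_simp
      _ ≤ (A.card * (4 * t) ^ p) ^ (1 / p) :=
          Real.rpow_le_rpow (by positivity) h4 (by positivity)
      _ = _ := by
          rw [Real.mul_rpow (by positivity) (by positivity), ← Real.rpow_mul (by positivity),
            mul_one_div_cancel (by linarith), Real.rpow_one, mul_comm]
  obtain ⟨A, hAS, hAc, hW⟩ := weak_of_avg (1 / p) (4 * t) (by positivity) (by positivity) hα m K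
    (le_max_left _ _) (by
      rw [div_le_iff₀ (by linarith)] at hK0
      have : (K0 : ℝ) ≤ K := by exact_mod_cast le_max_right _ _
      nlinarith) x S hS hR
  exact reindex x A (2 ^ m) hAc t _ ht (fun i hi => (hx i (hAS hi)).1.le)
    (fun f hf => (hW f hf).trans (le_of_eq (by ring)))
end GapProof

namespace GapProof
variable {V : Type*} [NormedAddCommGroup V] [NormedSpace ℝ V]

abbrev Eu (n : ℕ) := EuclideanSpace ℝ (Fin n)

lemma dr_extremal (n : ℕ) (J : Eu n →L[ℝ] V) (hJ : Function.Injective J) :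
    ∃ u : Eu n →L[ℝ] V, ‖u‖ ≤ 1 ∧ ∀ (T : Eu n →L[ℝ] Eu n) (s : ℝ), 0 < s →
      ‖u.comp T‖ ≤ s → |T.det| ≤ s ^ n := by
  obtain ⟨c, hc, hanti⟩ := LinearMap.exists_antilipschitzWith (J : Eu n →ₗ[ℝ] V)
    (LinearMap.ker_eq_bot.2 hJ)
  let K : Set (Eu n →L[ℝ] Eu n) := {A | ‖J.comp A‖ ≤ 1}
  have hcont : Continuous fun A : Eu n →L[ℝ] Eu n => ‖J.comp A‖ :=
    continuous_norm.comp (ContinuousLinearMap.compL ℝ (Eu n) (Eu n) V J).continuous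
  have hclosed : IsClosed K := isClosed_le hcont continuous_const
  have hbdd : Bornology.IsBounded K := by
    rw [isBounded_iff_forall_norm_le]
    refine ⟨c, fun A hA => ?_⟩
    apply ContinuousLinearMap.opNorm_le_bound _ c.coe_nonneg
    intro z
    have h1 : ‖A z‖ ≤ c * ‖J (A z)‖ := by
      have := hanti.le_mul_dist (A z) 0
      simpa using this
    have h2 : ‖J (A z)‖ ≤ 1 * ‖z‖ := (J.comp A).le_of_opNorm_le hA z
    rw [one_mul] at h2
    refine h1.trans ?_
    exact mul_le_mul_of_nonneg_left h2 c.coe_nonneg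
  have : ProperSpace (Eu n →L[ℝ] Eu n) := FiniteDimensional.proper ℝ _
  have hcomp : IsCompact K := Metric.isCompact_of_isClosed_isBounded hclosed hbdd
  have hne : K.Nonempty := ⟨0, by simp [K]⟩
  obtain ⟨A, hA, hmax⟩ := hcomp.exists_isMaxOn hne
    (f := fun A : Eu n →L[ℝ] Eu n => |A.det|)
    (ContinuousLinearMap.continuous_det.abs.continuousOn)
  have hscale : ∀ (B : Eu n →L[ℝ] Eu n) (s : ℝ), 0 < s → ‖J.comp B‖ ≤ s →
      |B.det| ≤ s ^ n * |A.det| := by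
    intro B s hs hB
    have h1 : s⁻¹ • B ∈ K := by
      change ‖J.comp (s⁻¹ • B)‖ ≤ 1
      rw [ContinuousLinearMap.comp_smul, norm_smul, norm_inv, Real.norm_eq_abs, abs_of_pos hs,
        inv_mul_le_one₀ hs]
      exact hB
    have h2 : |(s⁻¹ • B).det| ≤ |A.det| := hmax h1
    have h3 : (s⁻¹ • B).det = s⁻¹ ^ n * B.det := by
      unfold ContinuousLinearMap.det
      rw [ContinuousLinearMap.toLinearMap_smul, LinearMap.det_smul]
      simp
    rw [h3, abs_mul, abs_of_pos (by positivity), inv_pow, inv_mul_le_iff₀ (by positivity)] at h2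
    exact h2
  have hdet : 0 < |A.det| := by
    have h1 := hscale (ContinuousLinearMap.id ℝ _) (‖J.comp (ContinuousLinearMap.id ℝ _)‖ + 1)
      (by positivity) (by linarith)
    have h2 : (ContinuousLinearMap.id ℝ (Eu n)).det = 1 := by
      simp [ContinuousLinearMap.det]
    rw [h2, abs_one] at h1
    by_contra h3
    have : |A.det| = 0 := le_antisymm (not_lt.1 h3) (abs_nonneg _)
    rw [this, mul_zero] at h1
    linarith
  refine ⟨J.comp A, hA, fun T s hs hT => ?_⟩
  have h1 := hscale (A.comp T) s hs (by rw [← ContinuousLinearMap.comp_assoc]; exact hT)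
  have h2 : (A.comp T).det = A.det * T.det := by
    unfold ContinuousLinearMap.det
    rw [ContinuousLinearMap.toLinearMap_comp, LinearMap.det_comp]
  rw [h2, abs_mul, mul_comm] at h1
  exact le_of_mul_le_mul_right h1 hdet

lemma dr_step (n k : ℕ) (u : Eu n →L[ℝ] V) (hu : ‖u‖ ≤ 1)
    (hext : ∀ (T : Eu n →L[ℝ] Eu n) (s : ℝ), 0 < s → ‖u.comp T‖ ≤ s → |T.det| ≤ s ^ n)
    (hk : 2 * k < n) (b : OrthonormalBasis (Fin n) ℝ (Eu n)) :
    ∃ z : Eu n, ‖z‖ = 1 ∧ (∀ i : Fin n, (i : ℕ) < k → inner ℝ (b i) z = 0) ∧ 1 / 3 ≤ ‖u z‖ := by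
  by_contra hcon
  push Not at hcon
  let W : Submodule ℝ (Eu n) := (Submodule.span ℝ (b '' {i : Fin n | (i : ℕ) < k}))ᗮ
  have hW : ∀ z ∈ W, ∀ i : Fin n, (i : ℕ) < k → inner ℝ (b i) z = 0 := by
    intro z hz i hi
    exact (Submodule.mem_orthogonal _ z).1 hz (b i) (Submodule.subset_span ⟨i, hi, rfl⟩)
  have hWb : ∀ z ∈ W, ‖u z‖ ≤ 1 / 3 * ‖z‖ := by
    intro z hz
    by_cases h0 : z = 0
    · simp [h0]
    have hz0 : 0 < ‖z‖ := norm_pos_iff.2 h0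
    have h1 := hcon (‖z‖⁻¹ • z) (by rw [norm_smul, norm_inv, norm_norm, inv_mul_cancel₀ hz0.ne'])
      (fun i hi => by rw [inner_smul_right, hW z hz i hi, mul_zero])
    rw [map_smul, norm_smul, norm_inv, norm_norm, inv_mul_lt_iff₀ hz0] at h1
    linarith
  let T : Eu n →L[ℝ] Eu n := ContinuousLinearMap.id ℝ _ + (3:ℝ) • W.starProjection
  have hT : ‖u.comp T‖ ≤ 2 := by
    apply ContinuousLinearMap.opNorm_le_bound _ (by norm_num)
    intro z
    have e : (u.comp T) z = u z + (3:ℝ) • u (W.starProjection z) := by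
      simp [T]
    rw [e]
    have h1 : ‖u z‖ ≤ 1 * ‖z‖ := u.le_of_opNorm_le hu z
    have h2 := hWb (W.starProjection z) (Submodule.starProjection_apply_mem W z)
    have h3 : ‖W.starProjection z‖ ≤ 1 * ‖z‖ :=
      W.starProjection.le_of_opNorm_le (Submodule.starProjection_norm_le W) z
    calc _ ≤ ‖u z‖ + ‖(3:ℝ) • u (W.starProjection z)‖ := norm_add_le _ _
      _ = ‖u z‖ + 3 * ‖u (W.starProjection z)‖ := by rw [norm_smul]; norm_num
      _ ≤ 2 * ‖z‖ := by linarith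
  have hdet : T.det = 4 ^ (n - k) := by
    have e1 : (T : Eu n →ₗ[ℝ] Eu n) = Matrix.toLin b.toBasis b.toBasis
        (Matrix.diagonal fun i : Fin n => if (i : ℕ) < k then (1:ℝ) else 4) := by
      apply b.toBasis.ext
      intro i
      rw [Matrix.toLin_self]
      simp only [OrthonormalBasis.coe_toBasis, Matrix.diagonal_apply, ite_smul, zero_smul]
      rw [Finset.sum_ite_eq' Finset.univ i]
      simp only [Finset.mem_univ, if_true]
      have e2 : (T : Eu n →ₗ[ℝ] Eu n) (b i) = b i + (3:ℝ) • W.starProjection (b i) := by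
        simp [T]
      rw [e2]
      by_cases hi : (i : ℕ) < k
      · have : W.starProjection (b i) = 0 := by
          rw [Submodule.starProjection_apply_eq_zero_iff]
          exact Submodule.le_orthogonal_orthogonal _ (Submodule.subset_span ⟨i, hi, rfl⟩)
        simp [this, hi]
      · have : W.starProjection (b i) = b i := by
          rw [Submodule.starProjection_eq_self_iff, Submodule.mem_orthogonal]
          intro w hw
          induction hw using Submodule.span_induction with
          | mem w hw =>
            obtain ⟨j, hj, rfl⟩ := hw
            rw [b.inner_eq_zero]
            rintro rfl
            exact hi hj
          | zero => simp
          | add x y _ _ hx hy => rw [inner_add_left, hx, hy, add_zero]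
          | smul a x _ hx => rw [inner_smul_left, hx, mul_zero]
        rw [this]
        simp only [hi, if_false]
        module
    unfold ContinuousLinearMap.det
    rw [e1, LinearMap.det_toLin, Matrix.det_diagonal, Finset.prod_ite]
    simp only [Finset.prod_const, one_pow, one_mul]
    congr 1
    have h1 := Finset.card_filter_add_card_filter_not (s := (univ : Finset (Fin n)))
      (fun i => (i : ℕ) < k)
    have h2 : (univ.filter (fun i : Fin n => (i : ℕ) < k)).card = k := by
      rw [Fin.card_filter_val_lt]
      omega
    rw [h2, Finset.card_univ, Fintype.card_fin] at h1
    omega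
  have h := hext T 2 (by norm_num) hT
  rw [hdet, abs_of_pos (by positivity), show (4:ℝ) = 2 ^ 2 by norm_num, ← pow_mul] at h
  have := (pow_le_pow_iff_right₀ (by norm_num : (1:ℝ) < 2)).1 h
  omega

lemma dr_basis (n : ℕ) (u : Eu n →L[ℝ] V) (hu : ‖u‖ ≤ 1)
    (hext : ∀ (T : Eu n →L[ℝ] Eu n) (s : ℝ), 0 < s → ‖u.comp T‖ ≤ s → |T.det| ≤ s ^ n)
    (k : ℕ) (hk : 2 * k ≤ n) :
    ∃ b : OrthonormalBasis (Fin n) ℝ (Eu n), ∀ i : Fin n, (i : ℕ) < k → 1 / 3 ≤ ‖u (b i)‖ := by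
  induction k with
  | zero => exact ⟨EuclideanSpace.basisFun _ _, by simp⟩
  | succ k ih =>
    obtain ⟨b, hb⟩ := ih (by omega)
    obtain ⟨z, hz1, hz2, hz3⟩ := dr_step n k u hu hext (by omega) b
    let v : Fin n → Eu n := Function.update b ⟨k, by omega⟩ z
    have hvk : v ⟨k, by omega⟩ = z := by simp [v]
    have hvi : ∀ i : Fin n, (i : ℕ) < k → v i = b i := by
      intro i hi
      apply Function.update_of_ne
      intro h
      rw [h] at hi
      simp at hi
    have hcase : ∀ i : Fin n, (i : ℕ) < k + 1 → (i : ℕ) < k ∨ i = ⟨k, by omega⟩ := by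
      intro i hi
      rcases Nat.lt_succ_iff_lt_or_eq.1 hi with h | h
      · exact Or.inl h
      · exact Or.inr (Fin.ext h)
    have hv : Orthonormal ℝ (Set.domRestrict {i : Fin n | (i : ℕ) < k + 1} v) := by
      constructor
      · rintro ⟨i, hi⟩
        simp only [Set.domRestrict_apply]
        rcases hcase i hi with h | h
        · rw [hvi i h]; exact b.norm_eq_one i
        · rw [h, hvk]; exact hz1
      · rintro ⟨i, hi⟩ ⟨j, hj⟩ hij
        have hij' : i ≠ j := fun h => hij (Subtype.ext h)
        simp only [Set.domRestrict_apply]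
        rcases hcase i hi with h | h <;> rcases hcase j hj with h' | h'
        · rw [hvi i h, hvi j h', b.inner_eq_zero hij']
        · rw [hvi i h, h', hvk, hz2 i h]
        · rw [hvi j h', h, hvk, real_inner_comm, hz2 j h']
        · exact absurd (h.trans h'.symm) hij'
    obtain ⟨b', hb'⟩ := hv.exists_orthonormalBasis_extension_of_card_eq (by simp)
    refine ⟨b', fun i hi => ?_⟩
    rw [hb' i hi]
    rcases hcase i hi with h | h
    · rw [hvi i h]; exact hb i h
    · rw [h, hvk]; exact hz3

lemma famQ_half (hV : ¬ FiniteDimensional ℝ V) : FamQ V (1 / 2) := by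
  refine ⟨3, by norm_num, fun m => ?_⟩
  set n := 2 ^ (m + 1) with hn
  obtain ⟨w, hw⟩ : ∃ w : Fin n → V, LinearIndependent ℝ w := by
    have hr : (n : Cardinal) ≤ Module.rank ℝ V := by
      have : Cardinal.aleph0 ≤ Module.rank ℝ V := by
        by_contra h
        exact hV (Module.rank_lt_aleph0_iff.1 (not_le.1 h))
      exact (Cardinal.natCast_lt_aleph0.le).trans this
    rw [le_rank_iff_exists_linearIndependent_finset] at hr
    obtain ⟨s, hs, hlin⟩ := hr
    let e : Fin n ≃ s := (Fintype.equivFinOfCardEq (by simpa using hs)).symm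
    exact ⟨fun i => (e i : V), hlin.comp e e.injective⟩
  let J0 : Eu n →ₗ[ℝ] V := (Fintype.linearCombination ℝ w).comp
    (WithLp.linearEquiv 2 ℝ (Fin n → ℝ)).toLinearMap
  let J : Eu n →L[ℝ] V := LinearMap.toContinuousLinearMap J0
  have hJ : Function.Injective J := by
    change Function.Injective J0
    have := linearIndependent_iff_injective_fintypeLinearCombination.1 hw
    exact this.comp (WithLp.linearEquiv 2 ℝ (Fin n → ℝ)).injective
  obtain ⟨u, hu, hext⟩ := dr_extremal n J hJ
  obtain ⟨b, hb⟩ := dr_basis n u hu hext (2 ^ m) (by rw [hn, pow_succ]; omega)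
  have hcard : (univ.filter (fun i : Fin n => (i : ℕ) < 2 ^ m)).card = 2 ^ m := by
    rw [Fin.card_filter_val_lt, hn, pow_succ]
    omega
  apply reindex (fun i => u (b i)) (univ.filter (fun i : Fin n => (i : ℕ) < 2 ^ m)) (2 ^ m) hcard
    (1 / 3) _ (by norm_num)
  · intro i hi
    exact hb i (Finset.mem_filter.1 hi).2
  · intro f hf
    let g : Eu n := (InnerProductSpace.toDual ℝ (Eu n)).symm (f.comp u)
    have hg : ∀ z, inner ℝ g z = f (u z) := fun z => by
      simp [g]
    have hgn : ‖g‖ ≤ 1 := by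
      simp only [g, LinearIsometryEquiv.norm_map]
      exact (ContinuousLinearMap.opNorm_comp_le f u).trans
        (mul_le_one₀ hf (norm_nonneg _) hu)
    have h1 := b.orthonormal.sum_inner_products_le g
      (s := univ.filter (fun i : Fin n => (i : ℕ) < 2 ^ m))
    have h2 := sq_sum_le_card_mul_sum_sq (s := univ.filter (fun i : Fin n => (i : ℕ) < 2 ^ m))
      (f := fun i => |f (u (b i))|)
    rw [hcard] at h2
    have h3 : ∑ i ∈ univ.filter (fun i : Fin n => (i : ℕ) < 2 ^ m), |f (u (b i))| ^ 2 ≤ 1 := by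
      refine le_trans (le_of_eq ?_) (h1.trans (pow_le_one₀ (norm_nonneg _) hgn))
      apply Finset.sum_congr rfl
      intro i _
      rw [real_inner_comm, hg, Real.norm_eq_abs]
    have h4 : (3 * ((2:ℝ) ^ m) ^ (1 / 2 : ℝ)) * (1 / 3) = √(2 ^ m) := by
      rw [Real.sqrt_eq_rpow]; ring
    rw [h4]
    apply Real.le_sqrt_of_sq_le
    refine h2.trans ?_
    push_cast
    have : (0:ℝ) ≤ 2 ^ m := by positivity
    nlinarith
end GapProof

namespace GapProof
variable {X : Type*} [NormedAddCommGroup X] [NormedSpace ℂ X]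

lemma weak_complex (n : ℕ) (x : ℕ → X) (c : ℝ) (hx : ∀ i < n, 1 ≤ ‖x i‖)
    (h : ∀ f : X →L[ℝ] ℝ, ‖f‖ ≤ 1 → ∑ i ∈ range n, |f (x i)| ≤ c) (g : X →L[ℂ] ℂ) :
    ∑ i ∈ range n, ‖g ((‖x i‖⁻¹ : ℝ) • x i)‖ ≤ 2 * (‖g‖ + 1) * c := by
  have hg : 0 < ‖g‖ + 1 := by positivity
  have hgen : ∀ φ : ℂ →L[ℝ] ℝ, ‖φ‖ ≤ 1 → ∑ i ∈ range n, |φ (g (x i))| ≤ (‖g‖ + 1) * c := by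
    intro φ hφ
    let f : X →L[ℝ] ℝ := (‖g‖ + 1)⁻¹ • φ.comp (g.restrictScalars ℝ)
    have hf : ‖f‖ ≤ 1 := by
      rw [norm_smul, norm_inv, Real.norm_eq_abs, abs_of_pos hg, inv_mul_le_one₀ hg]
      refine (ContinuousLinearMap.opNorm_comp_le _ _).trans ?_
      rw [ContinuousLinearMap.norm_restrictScalars]
      nlinarith [norm_nonneg g]
    have h1 := h f hf
    have h2 : ∀ i, |f (x i)| = (‖g‖ + 1)⁻¹ * |φ (g (x i))| := by
      intro i
      have : f (x i) = (‖g‖ + 1)⁻¹ * φ (g (x i)) := rfl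
      rw [this, abs_mul, abs_of_pos (inv_pos.2 hg)]
    simp only [h2, ← Finset.mul_sum] at h1
    rwa [inv_mul_le_iff₀ hg] at h1
  have h1 := hgen Complex.reCLM (by rw [Complex.reCLM_norm])
  have h2 := hgen Complex.imCLM (by rw [Complex.imCLM_norm])
  calc _ ≤ ∑ i ∈ range n, (|Complex.reCLM (g (x i))| + |Complex.imCLM (g (x i))|) := by
        apply Finset.sum_le_sum
        intro i hi
        have hxi := hx i (Finset.mem_range.1 hi)
        have e : g ((‖x i‖⁻¹ : ℝ) • x i) = (‖x i‖⁻¹ : ℝ) • g (x i) :=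
          (g.restrictScalars ℝ).map_smul _ _
        rw [e, norm_smul, norm_inv, norm_norm]
        have h3 : ‖x i‖⁻¹ ≤ 1 := inv_le_one_of_one_le₀ hxi
        have h4 := Complex.norm_le_abs_re_add_abs_im (g (x i))
        calc _ ≤ 1 * ‖g (x i)‖ := by gcongr
          _ ≤ _ := by rw [one_mul]; exact h4
    _ ≤ _ := by rw [Finset.sum_add_distrib]; linarith

lemma summable_blocks (g : ℕ → ℝ) (hg : ∀ n, 0 ≤ g n) (D ρ : ℝ) (hD : 0 ≤ D) (hρ0 : 0 ≤ ρ)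
    (hρ : ρ < 1) (h : ∀ m : ℕ, ∑ i ∈ range (2 ^ m), g (2 ^ m + i) ≤ D * ρ ^ m) : Summable g := by
  have h1 : ∀ M : ℕ, ∑ i ∈ range (2 ^ M), g i ≤ g 0 + ∑ m ∈ range M, D * ρ ^ m := by
    intro M
    induction M with
    | zero => simp
    | succ M ih =>
      rw [pow_succ, mul_two, Finset.sum_range_add, Finset.sum_range_succ]
      have := h M
      linarith
  have hs : Summable fun m : ℕ => D * ρ ^ m := (summable_geometric_of_lt_one hρ0 hρ).mul_left D
  apply summable_of_sum_range_le (c := g 0 + ∑' m : ℕ, D * ρ ^ m) hg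
  intro N
  calc _ ≤ ∑ i ∈ range (2 ^ N), g i := by
        apply Finset.sum_le_sum_of_subset_of_nonneg
        · exact Finset.range_subset_range.2 Nat.lt_two_pow_self.le
        · intro i _ _; exact hg i
    _ ≤ _ := h1 N
    _ ≤ _ := by
        have := hs.sum_le_tsum (range N) (fun i _ => by positivity)
        linarith

lemma lower_of_famQ [CompleteSpace X] (α : ℝ) (hα : 0 ≤ α) (h : FamQ X α) :
    ((1 - α : ℝ) : EReal) ≤ dirichletGapA X := by
  obtain ⟨C, hC, hfam⟩ := h
  choose x hx hw using hfam
  let a : ℕ → X := fun n =>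
    (‖x (Nat.log 2 n) (n - 2 ^ Nat.log 2 n)‖⁻¹ : ℝ) • x (Nat.log 2 n) (n - 2 ^ Nat.log 2 n)
  have ha1 : ∀ n, ‖a (n + 1)‖ = 1 := by
    intro n
    have h1 : (n + 1) < 2 ^ (Nat.log 2 (n + 1) + 1) := Nat.lt_pow_succ_log_self (by norm_num) _
    have h2 : n + 1 - 2 ^ Nat.log 2 (n + 1) < 2 ^ Nat.log 2 (n + 1) := by
      rw [pow_succ] at h1
      have := Nat.pos_of_ne_zero (pow_ne_zero (Nat.log 2 (n + 1)) (two_ne_zero (α := ℕ)))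
      omega
    have h3 := hx _ _ h2
    simp only [a, norm_smul, norm_inv, norm_norm]
    exact inv_mul_cancel₀ (by linarith)
  have hab : ∀ m i, i < 2 ^ m → a (2 ^ m + i) = (‖x m i‖⁻¹ : ℝ) • x m i := by
    intro m i hi
    have : Nat.log 2 (2 ^ m + i) = m := by
      rw [Nat.log_eq_iff (Or.inr ⟨by norm_num, by have := pow_pos (two_pos (α := ℕ)) m; omega⟩)]
      rw [pow_succ]; omega
    simp only [a, this, Nat.add_sub_cancel_left]
  have hsum1 : ∀ σ : ℝ, (Summable fun n : ℕ => ((n + 1 : ℕ) : ℝ) ^ (-σ)) ↔ 1 < σ := by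
    intro σ
    rw [summable_nat_add_iff 1 (f := fun n : ℕ => (n : ℝ) ^ (-σ)), Real.summable_nat_rpow]
    constructor <;> intro h <;> linarith
  have hσc : dirichletSigmaC a < ⊤ := by
    refine lt_of_le_of_lt (sInf_le ⟨1, rfl, ?_⟩) (EReal.coe_lt_top 1)
    intro s hs
    have hs' : Summable fun n : ℕ => (((n + 1 : ℕ) : ℂ) ^ (-s)) • a (n + 1) := by
      apply Summable.of_norm
      refine ((hsum1 s.re).2 hs).congr ?_
      intro n
      rw [norm_smul, ha1, mul_one, Complex.norm_natCast_cpow_of_pos (Nat.succ_pos n)]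
      simp
    exact ⟨_, hs'.hasSum.tendsto_sum_nat⟩
  have hσa : (1 : EReal) ≤ dirichletSigmaA a := by
    apply le_sInf
    rintro _ ⟨r, rfl, hr⟩
    by_contra hlt
    push Not at hlt
    have hlt' : r < 1 := by exact_mod_cast hlt
    have h1 := hr 1 hlt'
    simp only [ha1, one_mul] at h1
    exact lt_irrefl _ ((hsum1 1).1 h1)
  have hσw : dirichletSigmaAw a ≤ (α : EReal) := by
    apply iSup_le
    intro g
    apply sInf_le
    refine ⟨α, rfl, ?_⟩
    intro σ hσ
    have hs := summable_blocks (fun n => ‖g (a n)‖ * (n : ℝ) ^ (-σ)) (fun n => by positivity)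
      (2 * (‖g‖ + 1) * C) ((2:ℝ) ^ (α - σ)) (by positivity) (by positivity)
      (Real.rpow_lt_one_of_one_lt_of_neg (by norm_num) (by linarith))
      (by
        intro m
        have h1 := weak_complex (2 ^ m) (x m) _ (hx m) (hw m) g
        calc _ ≤ ∑ i ∈ range (2 ^ m), ‖g ((‖x m i‖⁻¹ : ℝ) • x m i)‖ * ((2:ℝ) ^ m) ^ (-σ) := by
              apply Finset.sum_le_sum
              intro i hi
              rw [hab m i (Finset.mem_range.1 hi)]
              apply mul_le_mul_of_nonneg_left _ (norm_nonneg _)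
              apply Real.rpow_le_rpow_of_nonpos (by positivity) _ (by linarith)
              push_cast
              linarith [Nat.cast_nonneg (α := ℝ) i]
          _ ≤ (2 * (‖g‖ + 1) * (C * ((2:ℝ) ^ m) ^ α)) * ((2:ℝ) ^ m) ^ (-σ) := by
              rw [← Finset.sum_mul]
              gcongr
          _ = _ := by
              have : ((2:ℝ) ^ (α - σ)) ^ m = ((2:ℝ) ^ m) ^ α * ((2:ℝ) ^ m) ^ (-σ) := by
                rw [← Real.rpow_add (by positivity), ← Real.rpow_natCast, ← Real.rpow_natCast,
                  ← Real.rpow_mul (by norm_num), ← Real.rpow_mul (by norm_num)]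
                congr 1; ring
              rw [this]; ring)
    exact (summable_nat_add_iff 1 (f := fun n : ℕ => ‖g (a n)‖ * (n : ℝ) ^ (-σ))).2 hs
  have : ((1 - α : ℝ) : EReal) ≤ dirichletSigmaA a - dirichletSigmaAw a := by
    rw [EReal.coe_sub]
    exact EReal.sub_le_sub hσa hσw
  exact this.trans (le_sSup ⟨a, hσc, rfl⟩)

lemma summable_of_sigmaA_lt {Y : Type*} [SeminormedAddCommGroup Y] (a : ℕ → Y) (r : ℝ)
    (h : dirichletSigmaA a < (r : EReal)) :
    Summable (fun n : ℕ => ‖a (n + 1)‖ * ((n + 1 : ℕ) : ℝ) ^ (-r)) := by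
  obtain ⟨_, ⟨r', rfl, hr'⟩, hlt⟩ := sInf_lt_iff.1 h
  exact hr' r (by exact_mod_cast hlt)

lemma unif_bound (b : ℕ → X) (h : ∀ g : X →L[ℂ] ℂ, Summable fun n => ‖g (b n)‖) :
    ∃ M : ℝ, ∀ (N : ℕ) (ε : Fin N → Bool), ‖∑ n : Fin N, sg (ε n) • b n‖ ≤ M := by
  let I := Σ N : ℕ, (Fin N → Bool)
  let v : I → X := fun i => ∑ n : Fin i.1, sg (i.2 n) • b n
  obtain ⟨M, hM⟩ := banach_steinhaus (g := fun i : I => NormedSpace.inclusionInDoubleDual ℂ X (v i))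
    (by
      intro g
      refine ⟨∑' n, ‖g (b n)‖, ?_⟩
      rintro ⟨N, ε⟩
      change ‖g (∑ n : Fin N, sg (ε n) • b n)‖ ≤ _
      rw [map_sum]
      refine (norm_sum_le _ _).trans ?_
      have e : ∀ n : Fin N, ‖g (sg (ε n) • b n)‖ = ‖g (b n)‖ := by
        intro n
        have e : g (sg (ε n) • b n) = sg (ε n) • g (b n) :=
          (g.restrictScalars ℝ).map_smul _ _
        rw [e, norm_smul, Real.norm_eq_abs, abs_sg, one_mul]
      simp only [e]
      rw [← Finset.sum_range (fun n => ‖g (b n)‖)]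
      exact (h g).sum_le_tsum _ (fun _ _ => norm_nonneg _))
  refine ⟨M, fun N ε => ?_⟩
  have := hM ⟨N, ε⟩
  rwa [show ‖NormedSpace.inclusionInDoubleDual ℂ X (v ⟨N, ε⟩)‖ = ‖v ⟨N, ε⟩‖ from
    (NormedSpace.inclusionInDoubleDualLi ℂ).norm_map _] at this

lemma upper_aux (p : ℝ) (hp : 2 ≤ p) (hcot : HasCotype X p) (a : ℕ → X) (r : ℝ)
    (hr : dirichletSigmaAw a < (r : EReal)) :
    dirichletSigmaA a ≤ ((r + (1 - 1 / p) : ℝ) : EReal) := by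
  let b : ℕ → X := fun n => (((n + 1 : ℕ) : ℝ) ^ (-r)) • a (n + 1)
  have hbn : ∀ n, ‖b n‖ = ‖a (n + 1)‖ * ((n + 1 : ℕ) : ℝ) ^ (-r) := by
    intro n
    rw [norm_smul, Real.norm_eq_abs, abs_of_nonneg (by positivity), mul_comm]
  obtain ⟨M, hM⟩ := unif_bound b (by
    intro g
    have h1 : dirichletSigmaA (fun n => g (a n)) < (r : EReal) :=
      lt_of_le_of_lt (le_iSup (fun g : X →L[ℂ] ℂ => dirichletSigmaA (fun n => g (a n))) g) hr
    refine (summable_of_sigmaA_lt _ r h1).congr ?_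
    intro n
    have e : g (b n) = (((n + 1 : ℕ) : ℝ) ^ (-r)) • g (a (n + 1)) :=
      (g.restrictScalars ℝ).map_smul _ _
    rw [e, norm_smul, Real.norm_eq_abs, abs_of_nonneg (by positivity), mul_comm])
  have hM0 : 0 ≤ M := (norm_nonneg _).trans (hM 0 (fun _ => true))
  obtain ⟨C, hC, hcot⟩ := hcot
  have hp0 : 0 < p := by linarith
  have hbp : Summable fun n => ‖b n‖ ^ p := by
    apply summable_of_sum_range_le (c := (C * M) ^ p) (fun n => by positivity)
    intro N
    rw [Finset.sum_range]
    have h1 := hcot N (fun i => b i)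
    rw [cotype_expr] at h1
    have h2 : Q2 (fun i : Fin N => b i) univ ≤ M ^ 2 := by
      unfold Q2
      rw [inv_mul_le_iff₀ cd_pos]
      calc _ ≤ ∑ ε : Fin N → Bool, M ^ 2 := by
            apply Finset.sum_le_sum
            intro ε _
            have := hM N ε
            gcongr
        _ = _ := by simp [cd]
    have h3 : (Q2 (fun i : Fin N => b i) univ) ^ ((1:ℝ) / 2) ≤ M := by
      rw [← Real.sqrt_eq_rpow]
      exact Real.sqrt_le_iff.2 ⟨hM0, h2⟩
    have h4 : (∑ i : Fin N, ‖b i‖ ^ p) ^ (1 / p) ≤ C * M :=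
      h1.trans (mul_le_mul_of_nonneg_left h3 hC.le)
    have h0 : 0 ≤ ∑ i : Fin N, ‖b i‖ ^ p := Finset.sum_nonneg fun i _ => by positivity
    calc _ = ((∑ i : Fin N, ‖b i‖ ^ p) ^ (1 / p)) ^ p := by
          rw [← Real.rpow_mul h0, one_div_mul_cancel hp0.ne', Real.rpow_one]
      _ ≤ _ := Real.rpow_le_rpow (by positivity) h4 hp0.le
  apply sInf_le
  refine ⟨_, rfl, ?_⟩
  intro σ hσ
  have hip : 1 / p ≤ 1 / 2 := by apply one_div_le_one_div_of_le <;> linarith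
  have hq0 : 0 < 1 - 1 / p := by linarith
  have hconj : p.HolderConjugate (1 - 1 / p)⁻¹ := by
    rw [Real.holderConjugate_iff]
    refine ⟨by linarith, ?_⟩
    rw [inv_inv]; field_simp; ring
  have hs := Real.summable_mul_of_Lp_Lq_of_nonneg hconj
    (f := fun n => ‖b n‖) (g := fun n : ℕ => ((n + 1 : ℕ) : ℝ) ^ (-(σ - r)))
    (fun _ => norm_nonneg _) (fun _ => by positivity) hbp (by
      have h1 : Summable fun n : ℕ => (n : ℝ) ^ (-(σ - r) * (1 - 1 / p)⁻¹) := by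
        rw [Real.summable_nat_rpow, neg_mul, neg_lt_neg_iff, ← div_eq_mul_inv, lt_div_iff₀ hq0]
        linarith
      refine ((summable_nat_add_iff 1).2 h1).congr ?_
      intro n
      rw [← Real.rpow_mul (by positivity)])
  refine hs.congr ?_
  intro n
  rw [hbn, mul_assoc, ← Real.rpow_add (by positivity)]
  congr 2
  ring

lemma upper (p : ℝ) (hp : 2 ≤ p) (hcot : HasCotype X p) :
    dirichletGapA X ≤ ((1 - 1 / p : ℝ) : EReal) := by
  apply sSup_le
  rintro _ ⟨a, -, rfl⟩
  apply EReal.sub_le_of_le_add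
  have key := upper_aux p hp hcot a
  induction hs : dirichletSigmaAw a with
  | top => rw [EReal.coe_add_top]; exact le_top
  | bot =>
    rw [EReal.add_bot, le_bot_iff, EReal.eq_bot_iff_forall_lt]
    intro y
    refine lt_of_le_of_lt (key (y - 1 - (1 - 1 / p)) (by rw [hs]; exact EReal.bot_lt_coe _)) ?_
    exact_mod_cast (by linarith)
  | coe s =>
    rw [← EReal.coe_add, ← EReal.le_of_forall_lt_iff_le]
    intro z hz
    have hz' : 1 - 1 / p + s < z := by exact_mod_cast hz
    have := key (z - (1 - 1 / p)) (by rw [hs]; exact_mod_cast (by linarith))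
    simpa using this

end GapProof

/-- For an infinite-dimensional complex Banach space `X` of finite cotype,
`G_a(X) = 1 - 1/Cot(X)` where `Cot(X) = inf{p ∈ [2,∞) : X has cotype p}`. -/
theorem gapA_eq_one_sub_inv_cotype
    (X : Type*) [NormedAddCommGroup X] [NormedSpace ℂ X] [CompleteSpace X]
    (hX : ¬ FiniteDimensional ℂ X)
    (hq : ∃ q : ℝ, 2 ≤ q ∧ HasCotype X q) :
    dirichletGapA X = ((1 - 1 / sInf {p : ℝ | 2 ≤ p ∧ HasCotype X p} : ℝ) : EReal) := by
  set P : Set ℝ := {p : ℝ | 2 ≤ p ∧ HasCotype X p} with hP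
  have hne : P.Nonempty := hq
  have hbdd : BddBelow P := ⟨2, fun p hp => hp.1⟩
  set q := sInf P with hqdef
  have hq2 : 2 ≤ q := le_csInf hne fun p hp => hp.1
  apply le_antisymm
  · rw [← EReal.le_of_forall_lt_iff_le]
    intro c hc
    have hc' : 1 - 1 / q < c := by exact_mod_cast hc
    have : ∃ p ∈ P, 1 - 1 / p ≤ c := by
      by_cases h1 : 1 ≤ c
      · obtain ⟨p, hp⟩ := hne
        refine ⟨p, hp, ?_⟩
        have : 0 < 1 / p := by have := hp.1; positivity
        linarith
      · push Not at h1
        have h2 : q < 1 / (1 - c) := by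
          rw [lt_one_div (by linarith) (by linarith)]; linarith
        obtain ⟨p, hp, hlt⟩ := exists_lt_of_csInf_lt hne h2
        refine ⟨p, hp, ?_⟩
        have hp0 : 0 < p := by linarith [hp.1]
        rw [lt_one_div hp0 (by linarith)] at hlt
        linarith
    obtain ⟨p, hp, hle⟩ := this
    exact (GapProof.upper p hp.1 hp.2).trans (by exact_mod_cast hle)
  · have hXR : ¬ FiniteDimensional ℝ X := fun h =>
      hX (Module.Finite.of_restrictScalars_finite ℝ ℂ X)
    have hhalf := GapProof.lower_of_famQ (X := X) (1 / 2) (by norm_num) (GapProof.famQ_half hXR)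
    apply le_of_forall_lt
    intro e he
    obtain ⟨c, hec, hcq⟩ := EReal.lt_iff_exists_real_btwn.1 he
    refine lt_of_lt_of_le hec ?_
    have hc' : c < 1 - 1 / q := by exact_mod_cast hcq
    by_cases h1 : c ≤ 1 / 2
    · refine le_trans ?_ hhalf
      exact_mod_cast (by linarith : c ≤ 1 - 1 / 2)
    · push Not at h1
      have hq0 : 0 < 1 / q := by positivity
      have hc1 : 0 < 1 - c := by linarith
      have h2 : 1 / (1 - c) < q := by
        rw [one_div_lt hc1 (by linarith)]; linarith
      have h3 : 2 < 1 / (1 - c) := by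
        rw [lt_one_div (by norm_num) hc1]; linarith
      have h4 : ¬ HasCotype X (1 / (1 - c)) := fun h =>
        notMem_of_lt_csInf h2 hbdd ⟨h3.le, h⟩
      have h5 := GapProof.lower_of_famQ (X := X) _ (by positivity)
        (GapProof.famQ_of_not_cotype _ h3 h4)
      simpa using h5
end
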